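/- arXiv:2003.02127 — 4 statements merged into one kernel-verified Lean document; each statement's English description precedes it below -/
import Mathlib

section
/- Let f : ℝⁿ → ℝⁿ be real analytic on a neighbourhood of 0 with f(0)=0, and let Df(x) denote its Jacobian matrix at x. Then there exist constants C, δ > 0 such that ‖x‖·|det Df(x)| ≤ C·‖f(x)‖ for all ‖x‖ ≤ δ. -/
open scoped TensorProduct

theorem MvPolynomial.exists_aeval_sub_aeval_eq_sum {K S R ι : Type*} [Fintype ι] [CommRing K]
    [CommRing S] [Algebra K S] [CommRing R] [Algebra K R] (μ : S →ₐ[K] R) (a b : ι → S)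
    (hab : ∀ i, μ (a i) = μ (b i)) (P : MvPolynomial ι K) :
    ∃ H : ι → S, MvPolynomial.aeval a P - MvPolynomial.aeval b P = ∑ i, H i * (a i - b i) ∧
      ∀ i, μ (H i) = MvPolynomial.aeval (fun j => μ (a j)) (MvPolynomial.pderiv i P) := by
  classical
  have hμ : ∀ Q : MvPolynomial ι K,
      μ (MvPolynomial.aeval a Q) = MvPolynomial.aeval (fun j => μ (a j)) Q := fun Q => by
    rw [← MvPolynomial.comp_aeval_apply]
  induction P using MvPolynomial.induction_on with
  | C c => exact ⟨0, by simp, by simp⟩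
  | add p q hp hq =>
    obtain ⟨H, h1, h2⟩ := hp
    obtain ⟨H', h1', h2'⟩ := hq
    refine ⟨H + H', ?_, fun i => by simp [h2, h2']⟩
    simp only [map_add, Pi.add_apply, add_mul, Finset.sum_add_distrib, ← h1, ← h1']
    ring
  | mul_X p k hp =>
    obtain ⟨H, h1, h2⟩ := hp
    refine ⟨fun i => H i * b k + if i = k then MvPolynomial.aeval a p else 0, ?_, fun i => ?_⟩
    · have : ∑ i, (H i * b k + if i = k then MvPolynomial.aeval a p else 0) * (a i - b i) =
          b k * (∑ i, H i * (a i - b i)) + MvPolynomial.aeval a p * (a k - b k) := by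
        simp only [add_mul, Finset.sum_add_distrib, Finset.mul_sum, ite_mul, zero_mul,
          Finset.sum_ite_eq', Finset.mem_univ, if_true]
        congr 1
        exact Finset.sum_congr rfl fun i _ => by ring
      rw [this, ← h1]
      simp only [map_mul, MvPolynomial.aeval_X]
      ring
    · by_cases hik : i = k
      · subst hik
        simp [h2, hμ, hab]
        ring
      · simp [h2, hab, hik, MvPolynomial.pderiv_X_of_ne (Ne.symm hik), mul_comm]

/-- If `D` annihilates the kernel of multiplication `R ⊗ R → R`, then contracting its first factor
with the trace agrees with multiplying out. -/
theorem lid_rTensor_trace_eq_mul' {K R : Type*} [Field K] [CommRing R] [Algebra K R]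
    [Module.Finite K R] (D : R ⊗[K] R)
    (hD : ∀ r : R, D * (r ⊗ₜ 1) = D * (1 ⊗ₜ r)) :
    TensorProduct.lid K R ((Algebra.trace K R).rTensor R D) = LinearMap.mul' K R D := by
  classical
  let b := Module.finBasis K R
  have h1 : ∀ D : R ⊗[K] R, TensorProduct.lid K R ((Algebra.trace K R).rTensor R D) =
      ∑ i, TensorProduct.lid K R ((b.coord i).rTensor R (D * (b i ⊗ₜ 1))) := by
    intro D
    induction D using TensorProduct.induction_on with
    | zero => simp
    | add x y hx hy => simp only [map_add, add_mul, hx, hy, Finset.sum_add_distrib]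
    | tmul x y =>
      simp [Algebra.trace_eq_matrix_trace b, Matrix.trace, Algebra.leftMulMatrix_eq_repr_mul,
        Finset.sum_smul]
  have h2 : ∀ D : R ⊗[K] R, LinearMap.mul' K R D =
      ∑ i, TensorProduct.lid K R ((b.coord i).rTensor R (D * (1 ⊗ₜ b i))) := by
    intro D
    induction D using TensorProduct.induction_on with
    | zero => simp
    | add x y hx hy => simp only [map_add, add_mul, hx, hy, Finset.sum_add_distrib]
    | tmul x y =>
      conv_lhs => rw [LinearMap.mul'_apply, ← b.sum_repr x, Finset.sum_mul]
      simp [mul_comm]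
  rw [h1, h2]
  simp only [hD]

theorem mul_linearMapMul_eq_zero_of_isNilpotent {K R : Type*} [Field K] [CommRing R] [Algebra K R]
    [Module.Finite K R] (D : R ⊗[K] R)
    (hD : ∀ r : R, D * (r ⊗ₜ 1) = D * (1 ⊗ₜ r)) {x : R} (hx : IsNilpotent x) :
    x * LinearMap.mul' K R D = 0 := by
  have h1 : ∀ D : R ⊗[K] R, x * TensorProduct.lid K R ((Algebra.trace K R).rTensor R D) =
      TensorProduct.lid K R ((Algebra.trace K R).rTensor R (D * (1 ⊗ₜ x))) := by
    intro D
    induction D using TensorProduct.induction_on with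
    | zero => simp
    | add y z hy hz => simp only [map_add, add_mul, mul_add, hy, hz]
    | tmul y z => simp [mul_comm]
  have h2 : ∀ D : R ⊗[K] R,
      TensorProduct.lid K R ((Algebra.trace K R).rTensor R (D * (x ⊗ₜ 1))) = 0 := by
    intro D
    induction D using TensorProduct.induction_on with
    | zero => simp
    | add y z hy hz => simp only [map_add, add_mul, hy, hz, add_zero]
    | tmul y z =>
      have : Algebra.trace K R (y * x) = 0 :=
        (Algebra.isNilpotent_trace_of_isNilpotent ((Commute.all y x).isNilpotent_mul_left hx)).eq_zero
      simp [this]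
  rw [← lid_rTensor_trace_eq_mul' D hD, h1, ← hD, h2]

theorem mul_aeval_det_pderiv_eq_zero {K R ι : Type*} [Field K] [CommRing R] [Algebra K R]
    [Fintype ι] [DecidableEq ι] (P : ι → MvPolynomial ι K) (x : ι → R)
    (hsurj : Function.Surjective (MvPolynomial.aeval (R := K) x))
    (hx : ∀ i, IsNilpotent (x i)) (hP : ∀ j, MvPolynomial.aeval x (P j) = 0) (i : ι) :
    x i * MvPolynomial.aeval x (Matrix.of fun j i => MvPolynomial.pderiv i (P j)).det = 0 := by
  have hfin : Module.Finite K R := by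
    have : Algebra.IsIntegral K R := by
      have htop : Algebra.adjoin K (Set.range x) = ⊤ := by
        rw [Algebra.adjoin_range_eq_range_aeval, AlgHom.range_eq_top]
        exact hsurj
      refine ⟨fun r => ?_⟩
      have hr : r ∈ Algebra.adjoin K (Set.range x) := htop ▸ Algebra.mem_top
      refine (Algebra.adjoin_le (S := integralClosure K R) ?_) hr
      rintro _ ⟨i, rfl⟩
      obtain ⟨k, hk⟩ := hx i
      have : IsIntegral K (x i ^ (k + 1)) := by
        rw [pow_succ, hk, zero_mul]; exact isIntegral_zero
      exact IsIntegral.of_pow k.succ_pos this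
    have : Algebra.FiniteType K R := Algebra.FiniteType.of_surjective _ hsurj
    exact Algebra.IsIntegral.finite
  let a : ι → R ⊗[K] R := fun i => x i ⊗ₜ 1
  let b : ι → R ⊗[K] R := fun i => 1 ⊗ₜ x i
  let μ : R ⊗[K] R →ₐ[K] R := Algebra.TensorProduct.lmul' K
  have hμa : (fun i => μ (a i)) = x := by ext i; simp [μ, a]
  have haL : ∀ Q : MvPolynomial ι K,
      MvPolynomial.aeval a Q = (MvPolynomial.aeval x Q : R) ⊗ₜ[K] (1 : R) := fun Q =>
    (MvPolynomial.comp_aeval_apply x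
      (Algebra.TensorProduct.includeLeft : R →ₐ[K] R ⊗[K] R) Q).symm
  have hbR : ∀ Q : MvPolynomial ι K,
      MvPolynomial.aeval b Q = (1 : R) ⊗ₜ[K] (MvPolynomial.aeval x Q : R) := fun Q =>
    (MvPolynomial.comp_aeval_apply x
      (Algebra.TensorProduct.includeRight : R →ₐ[K] R ⊗[K] R) Q).symm
  have hab : ∀ i, μ (a i) = μ (b i) := fun i => by simp [μ, a, b]
  choose H hH hHμ using fun j => MvPolynomial.exists_aeval_sub_aeval_eq_sum μ a b hab (P j)
  let M : Matrix ι ι (R ⊗[K] R) := Matrix.of H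
  have hMv : M.mulVec (fun i => a i - b i) = 0 := by
    ext j
    simp only [Matrix.mulVec, dotProduct, M, Matrix.of_apply, Pi.zero_apply]
    rw [← hH, haL, hbR, hP]
    simp
  have hdet : ∀ i, M.det * (a i - b i) = 0 := fun i => by
    have h := congrArg (M.adjugate.mulVec) hMv
    rw [Matrix.mulVec_mulVec, Matrix.adjugate_mul, Matrix.mulVec_zero, Matrix.smul_mulVec,
      Matrix.one_mulVec] at h
    exact congrFun h i
  have hD : ∀ r : R, M.det * (r ⊗ₜ 1) = M.det * (1 ⊗ₜ r) := by
    intro r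
    obtain ⟨Q, rfl⟩ := hsurj r
    obtain ⟨G, hG, -⟩ := MvPolynomial.exists_aeval_sub_aeval_eq_sum μ a b hab Q
    rw [← sub_eq_zero, ← mul_sub, ← haL, ← hbR, hG, Finset.mul_sum]
    exact Finset.sum_eq_zero fun i _ => by rw [mul_left_comm, hdet, mul_zero]
  have key := mul_linearMapMul_eq_zero_of_isNilpotent M.det hD (hx i)
  have hμD : LinearMap.mul' K R M.det =
      MvPolynomial.aeval x (Matrix.of fun j i => MvPolynomial.pderiv i (P j)).det := by
    change μ M.det = _
    rw [AlgHom.map_det, AlgHom.map_det]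
    congr 1
    ext j i
    simp only [AlgHom.mapMatrix_apply, Matrix.map_apply, M, Matrix.of_apply, hHμ, hμa]
  rwa [hμD] at key

theorem MvPolynomial.X_mul_det_pderiv_mem {K ι : Type*} [Field K] [Fintype ι] [DecidableEq ι]
    (P : ι → MvPolynomial ι K) (I : Ideal (MvPolynomial ι K)) (hP : ∀ j, P j ∈ I) (N : ℕ)
    (hX : ∀ i, (X i : MvPolynomial ι K) ^ N ∈ I) (i : ι) :
    X i * (Matrix.of fun j i => pderiv i (P j)).det ∈ I := by
  have haev : ∀ Q : MvPolynomial ι K,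
      aeval (fun i => Ideal.Quotient.mk I (X i)) Q = Ideal.Quotient.mk I Q := fun Q => by
    have : aeval (fun i => Ideal.Quotient.mk I (X i)) = Ideal.Quotient.mkₐ K I :=
      algHom_ext fun i => by simp [Ideal.Quotient.mkₐ_eq_mk]
    rw [this]; rfl
  have key := mul_aeval_det_pderiv_eq_zero P (fun i => Ideal.Quotient.mk I (X i))
    (fun r => by
      obtain ⟨Q, rfl⟩ := Ideal.Quotient.mk_surjective r
      exact ⟨Q, haev Q⟩)
    (fun i => ⟨N, by rw [← map_pow]; exact Ideal.Quotient.eq_zero_iff_mem.2 (hX i)⟩)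
    (fun j => by rw [haev]; exact Ideal.Quotient.eq_zero_iff_mem.2 (hP j)) i
  rw [haev, ← map_mul] at key
  exact Ideal.Quotient.eq_zero_iff_mem.1 key
namespace MvPowerSeries

/-- The ideal of power series all of whose coefficients in degree less than `N` vanish. -/
def degreeGE (ι K : Type*) [CommRing K] (N : ℕ) : Ideal (MvPowerSeries ι K) where
  carrier := {G | ∀ α : ι →₀ ℕ, α.degree < N → coeff α G = 0}
  add_mem' {a b} ha hb α hα := by simp [ha α hα, hb α hα]
  zero_mem' α _ := by simp
  smul_mem' c G hG α hα := by
    classical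
    rw [smul_eq_mul, coeff_mul]
    refine Finset.sum_eq_zero fun p hp => ?_
    rw [hG p.2, mul_zero]
    have : p.2 ≤ α := by
      rw [← Finset.HasAntidiagonal.mem_antidiagonal.1 hp]; exact le_add_self
    exact (Finsupp.degree_mono this).trans_lt hα

theorem mem_degreeGE {ι K : Type*} [CommRing K] {N : ℕ} {G : MvPowerSeries ι K} :
    G ∈ degreeGE ι K N ↔ ∀ α : ι →₀ ℕ, α.degree < N → coeff α G = 0 := Iff.rfl

theorem exists_mem_span_X_mul_det_pderiv_sub_mem {K ι : Type*} [Field K] [Fintype ι]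
    [DecidableEq ι] (F : ι → MvPowerSeries ι K) (i : ι) (N : ℕ) :
    ∃ g ∈ Submodule.span (MvPolynomial ι K) (Set.range F),
      X i * (Matrix.of fun j i => pderiv K i (F j)).det - g ∈ degreeGE ι K N := by
  let P : ι → MvPolynomial ι K := fun j => truncTotal (N + 1) (F j)
  let I := Submodule.span (MvPolynomial ι K) (Set.range F)
  let J : Submodule (MvPolynomial ι K) (MvPowerSeries ι K) :=
    I ⊔ (degreeGE ι K N).restrictScalars (MvPolynomial ι K)
  let B : Ideal (MvPolynomial ι K) :=
    J.comap (Algebra.linearMap (MvPolynomial ι K) (MvPowerSeries ι K))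
  have hB : ∀ p, p ∈ B ↔ (p : MvPowerSeries ι K) ∈ J := fun p => by
    simp only [B, Submodule.mem_comap, Algebra.linearMap_apply]
    rw [algebraMap_apply']
    simp
  have hPF : ∀ j, (P j : MvPowerSeries ι K) - F j ∈ degreeGE ι K (N + 1) := fun j α hα => by
    rw [map_sub, MvPolynomial.coeff_coe, coeff_truncTotal _ hα, sub_self]
  have hmono : degreeGE ι K (N + 1) ≤ degreeGE ι K N := fun G hG α hα => hG α (by omega)
  have key := MvPolynomial.X_mul_det_pderiv_mem P B
    (fun j => by
      rw [hB, ← sub_add_cancel (P j : MvPowerSeries ι K) (F j)]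
      exact add_mem (Submodule.mem_sup_right (hmono (hPF j)))
        (Submodule.mem_sup_left (Submodule.subset_span ⟨j, rfl⟩)))
    N
    (fun i => by
      classical
      rw [hB]
      refine Submodule.mem_sup_right fun α hα => ?_
      rw [MvPolynomial.coeff_coe, MvPolynomial.coeff_X_pow, if_neg]
      rintro rfl
      simp at hα) i
  rw [hB] at key
  obtain ⟨g, hg, e, he, hge⟩ := Submodule.mem_sup.1 key
  refine ⟨g, hg, ?_⟩
  have hdet : (X i * (Matrix.of fun j i => pderiv K i (F j)).det : MvPowerSeries ι K) -
      ((MvPolynomial.X i * (Matrix.of fun j i => MvPolynomial.pderiv i (P j)).det :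
        MvPolynomial ι K) : MvPowerSeries ι K) ∈ degreeGE ι K N := by
    rw [← Ideal.Quotient.eq, ← MvPolynomial.coeToMvPowerSeries.ringHom_apply, map_mul, map_mul,
      map_mul, RingHom.map_det, RingHom.map_det, RingHom.map_det,
      MvPolynomial.coeToMvPowerSeries.ringHom_apply, MvPolynomial.coe_X]
    congr 2
    ext j k
    simp only [RingHom.mapMatrix_apply, Matrix.map_apply, Matrix.of_apply]
    rw [Ideal.Quotient.eq, MvPolynomial.coeToMvPowerSeries.ringHom_apply, ← pderiv_coe,
      ← map_sub, mem_degreeGE]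
    intro α hα
    rw [coeff_pderiv, ← neg_sub, map_neg, hPF j _ (by simpa using hα)]
    simp
  rw [← hge] at hdet
  have := add_mem hdet (show e ∈ degreeGE ι K N from he)
  convert this using 1
  ring

/-- The power series `F` converges absolutely on the closed polydisc of radius `ρ` and its sum
there is `φ`. -/
structure HasSumOn {ι : Type*} [Fintype ι] (ρ : ℝ) (F : MvPowerSeries ι ℝ)
    (φ : (ι → ℝ) → ℝ) : Prop where
  summable : Summable fun α => |coeff α F| * ρ ^ α.degree
  hasSum : ∀ x : ι → ℝ, (∀ i, |x i| ≤ ρ) →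
    HasSum (fun α => coeff α F * ∏ i, x i ^ α i) (φ x)

theorem prod_pow_le_pow_degree {ι : Type*} [Fintype ι] {ρ : ℝ} {x : ι → ℝ}
    (hx : ∀ i, |x i| ≤ ρ) (α : ι →₀ ℕ) : |∏ i, x i ^ α i| ≤ ρ ^ α.degree := by
  rw [Finsupp.degree_eq_sum, Finset.abs_prod, ← Finset.prod_pow_eq_pow_sum]
  refine Finset.prod_le_prod (fun i _ => abs_nonneg _) fun i _ => ?_
  rw [abs_pow]
  exact pow_le_pow_left₀ (abs_nonneg _) (hx i) _

namespace HasSumOn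

variable {ι : Type*} [Fintype ι] {ρ : ℝ} {F G : MvPowerSeries ι ℝ} {φ ψ : (ι → ℝ) → ℝ}

theorem of_summable
    (hs : Summable fun α => |coeff α F| * ρ ^ α.degree)
    (h : ∀ x : ι → ℝ, (∀ i, |x i| ≤ ρ) → ∑' α, coeff α F * ∏ i, x i ^ α i = φ x) :
    HasSumOn ρ F φ where
  summable := hs
  hasSum x hx := by
    rw [← h x hx]
    refine (Summable.of_norm_bounded hs fun α => ?_).hasSum
    rw [Real.norm_eq_abs, abs_mul]
    exact mul_le_mul_of_nonneg_left (prod_pow_le_pow_degree hx α) (abs_nonneg _)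

theorem mono {r : ℝ} (h : HasSumOn ρ F φ) (hr : 0 ≤ r) (hrρ : r ≤ ρ) : HasSumOn r F φ where
  summable := Summable.of_nonneg_of_le (fun α => by positivity)
    (fun α => mul_le_mul_of_nonneg_left (pow_le_pow_left₀ hr hrρ _) (abs_nonneg _)) h.summable
  hasSum x hx := h.hasSum x fun i => (hx i).trans hrρ

theorem congr (h : HasSumOn ρ F φ) (hφ : ∀ x : ι → ℝ, (∀ i, |x i| ≤ ρ) → φ x = ψ x) :
    HasSumOn ρ F ψ where
  summable := h.summable
  hasSum x hx := hφ x hx ▸ h.hasSum x hx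

theorem add (hρ : 0 ≤ ρ) (hF : HasSumOn ρ F φ) (hG : HasSumOn ρ G ψ) :
    HasSumOn ρ (F + G) (φ + ψ) where
  summable := Summable.of_nonneg_of_le (fun α => by positivity)
    (fun α => by
      rw [← add_mul, map_add]
      exact mul_le_mul_of_nonneg_right (abs_add_le _ _) (by positivity))
    (hF.summable.add hG.summable)
  hasSum x hx := by simpa [add_mul] using (hF.hasSum x hx).add (hG.hasSum x hx)

theorem neg (hF : HasSumOn ρ F φ) : HasSumOn ρ (-F) (-φ) where
  summable := by simpa using hF.summable
  hasSum x hx := by simpa using (hF.hasSum x hx).neg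

theorem monomial (α : ι →₀ ℕ) (c : ℝ) :
    HasSumOn ρ (MvPowerSeries.monomial α c) (fun x => c * ∏ i, x i ^ α i) := by
  classical
  refine ⟨summable_of_ne_finset_zero (s := {α}) fun β hβ => ?_, fun x _ => ?_⟩
  · rw [coeff_monomial_ne (by simpa using hβ)]; simp
  · have := hasSum_single (f := fun β => coeff β (MvPowerSeries.monomial α c) * ∏ i, x i ^ β i) α
      fun β hβ => by rw [coeff_monomial_ne hβ]; simp
    simpa using this

theorem summable_mul (hρ : 0 ≤ ρ) (hF : HasSumOn ρ F φ) (hG : HasSumOn ρ G ψ) :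
    Summable fun α => |coeff α (F * G)| * ρ ^ α.degree := by
  classical
  have h := summable_sum_mul_antidiagonal_of_summable_mul
    (f := fun α => |coeff α F| * ρ ^ α.degree) (g := fun α => |coeff α G| * ρ ^ α.degree)
    (hF.summable.mul_of_nonneg hG.summable (fun α => mul_nonneg (abs_nonneg _) (pow_nonneg hρ _))
      fun α => mul_nonneg (abs_nonneg _) (pow_nonneg hρ _))
  refine Summable.of_nonneg_of_le (fun α => by positivity) (fun α => ?_) h
  rw [coeff_mul]
  refine (mul_le_mul_of_nonneg_right (Finset.abs_sum_le_sum_abs _ _) (by positivity)).trans ?_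
  rw [Finset.sum_mul]
  refine (Finset.sum_congr rfl fun p hp => ?_).le
  rw [← Finset.HasAntidiagonal.mem_antidiagonal.1 hp, map_add, pow_add, abs_mul]
  ring

theorem mul (hρ : 0 ≤ ρ) (hF : HasSumOn ρ F φ) (hG : HasSumOn ρ G ψ) :
    HasSumOn ρ (F * G) (φ * ψ) := by
  classical
  refine of_summable (summable_mul hρ hF hG) fun x hx => ?_
  have h1 := hF.hasSum x hx
  have h2 := hG.hasSum x hx
  rw [Pi.mul_apply, ← h1.tsum_eq, ← h2.tsum_eq,
    h1.summable.tsum_mul_tsum_eq_tsum_sum_antidiagonal h2.summable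
      (summable_mul_of_summable_norm h1.summable.norm h2.summable.norm)]
  refine tsum_congr fun α => ?_
  rw [coeff_mul, Finset.sum_mul]
  refine Finset.sum_congr rfl fun p hp => ?_
  have : ∏ i, x i ^ α i = (∏ i, x i ^ p.1 i) * ∏ i, x i ^ p.2 i := by
    rw [← Finset.prod_mul_distrib, ← Finset.HasAntidiagonal.mem_antidiagonal.1 hp]
    exact Finset.prod_congr rfl fun i _ => by rw [Finsupp.add_apply, pow_add]
  rw [this]
  ring

theorem det {κ : Type*} [Fintype κ] [DecidableEq κ] (hρ : 0 ≤ ρ)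
    {M : Matrix κ κ (MvPowerSeries ι ℝ)} {A : κ → κ → (ι → ℝ) → ℝ}
    (h : ∀ i j, HasSumOn ρ (M i j) (A i j)) :
    HasSumOn ρ M.det (fun x => (Matrix.of fun i j => A i j x).det) := by
  let S : Subring (MvPowerSeries ι ℝ × ((ι → ℝ) → ℝ)) :=
    { carrier := {p | HasSumOn ρ p.1 p.2}
      mul_mem' := fun ha hb => mul hρ ha hb
      one_mem' := (monomial 0 1).congr fun x _ => by simp
      add_mem' := fun ha hb => add hρ ha hb
      zero_mem' := (monomial 0 0).congr (F := MvPowerSeries.monomial 0 0) (fun x _ => by simp) |>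
        fun h => by simpa using h
      neg_mem' := fun ha => neg ha }
  let B : Matrix κ κ (MvPowerSeries ι ℝ × ((ι → ℝ) → ℝ)) := Matrix.of fun i j => (M i j, A i j)
  have hB : B.det ∈ S := by
    rw [Matrix.det_apply]
    refine sum_mem fun σ _ => ?_
    rw [Units.smul_def]
    exact zsmul_mem (prod_mem fun i _ => h _ _) _
  have h1 : B.det.1 = M.det := by
    change RingHom.fst _ _ B.det = _
    rw [RingHom.map_det]
    rfl
  have h2 : ∀ x, B.det.2 x = (Matrix.of fun i j => A i j x).det := by
    intro x
    change ((Pi.evalRingHom (fun _ : ι → ℝ => ℝ) x).comp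
      (RingHom.snd (MvPowerSeries ι ℝ) ((ι → ℝ) → ℝ))) B.det = _
    rw [RingHom.map_det]
    rfl
  have hS : HasSumOn ρ B.det.1 B.det.2 := hB
  rw [h1] at hS
  exact hS.congr fun x _ => h2 x

theorem pderiv [DecidableEq ι] (hρ : 0 < ρ) (hF : HasSumOn ρ F φ) (i : ι) :
    HasSumOn (ρ / 4) (pderiv ℝ i F) (fun x => lineDeriv ℝ φ x (Pi.single i 1)) := by
  -- `D α y` is the value at `y` of the `i`-th partial derivative of the term of index `α`
  let D : (ι →₀ ℕ) → (ι → ℝ) → ℝ := fun α y =>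
    coeff α F * (α i * y i ^ (α i - 1) * ∏ j ∈ Finset.univ.erase i, y j ^ α j)
  have hDbound : ∀ α y, (∀ j, |y j| ≤ ρ / 2) → |D α y| ≤ |coeff α F| * ρ ^ α.degree * ρ⁻¹ := by
    intro α y hy
    simp only [D, abs_mul, mul_assoc]
    refine mul_le_mul_of_nonneg_left ?_ (abs_nonneg _)
    rcases Nat.eq_zero_or_pos (α i) with h0 | h0
    · simp only [h0, Nat.cast_zero, abs_zero, zero_mul]; positivity
    have hdeg : α.degree = α i + ∑ j ∈ Finset.univ.erase i, α j := by
      rw [Finsupp.degree_eq_sum, Finset.add_sum_erase _ _ (Finset.mem_univ i)]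
    obtain ⟨d, hd⟩ : ∃ d, α i = d + 1 := ⟨α i - 1, by omega⟩
    have h1 : |∏ j ∈ Finset.univ.erase i, y j ^ α j| ≤
        ρ ^ (∑ j ∈ Finset.univ.erase i, α j) := by
      rw [Finset.abs_prod, ← Finset.prod_pow_eq_pow_sum]
      refine Finset.prod_le_prod (fun j _ => abs_nonneg _) fun j _ => ?_
      rw [abs_pow]
      exact pow_le_pow_left₀ (abs_nonneg _) ((hy j).trans (by linarith)) _
    have h2 : |(α i : ℝ)| * |y i ^ (α i - 1)| ≤ ρ ^ d := by
      have h3 : |y i ^ (α i - 1)| ≤ (ρ / 2) ^ d := by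
        rw [abs_pow, hd, Nat.add_sub_cancel]
        exact pow_le_pow_left₀ (abs_nonneg _) (hy i) _
      have h4 : |(α i : ℝ)| ≤ 2 ^ d := by
        rw [Nat.abs_cast, hd]
        exact_mod_cast Nat.lt_two_pow_self (n := d)
      calc _ ≤ (2 : ℝ) ^ d * (ρ / 2) ^ d := by gcongr
        _ = ρ ^ d := by rw [← mul_pow]; congr 1; ring
    calc _ ≤ ρ ^ d * ρ ^ (∑ j ∈ Finset.univ.erase i, α j) := by
          rw [← mul_assoc]; gcongr
      _ = ρ ^ α.degree * ρ⁻¹ := by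
          rw [hdeg, hd, pow_add, pow_succ]; field_simp
  have hshift : ∀ y β, D (β + Finsupp.single i 1) y =
      coeff β (MvPowerSeries.pderiv ℝ i F) * ∏ j, y j ^ β j := by
    intro y β
    rw [coeff_pderiv, ← Finset.mul_prod_erase _ _ (Finset.mem_univ i)]
    have : ∏ j ∈ Finset.univ.erase i, y j ^ (β + Finsupp.single i 1 : ι →₀ ℕ) j =
        ∏ j ∈ Finset.univ.erase i, y j ^ β j :=
      Finset.prod_congr rfl fun j hj => by
        rw [Finsupp.add_apply, Finsupp.single_eq_of_ne (Finset.ne_of_mem_erase hj), add_zero]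
    simp only [D, this]
    simp
    ring
  have hinj : Function.Injective fun β : ι →₀ ℕ => β + Finsupp.single i 1 :=
    add_left_injective _
  have hrange : ∀ y, ∀ α ∉ Set.range fun β : ι →₀ ℕ => β + Finsupp.single i 1, D α y = 0 := by
    intro y α hα
    have : α i = 0 := by
      by_contra h0
      refine hα ⟨α - Finsupp.single i 1, tsub_add_cancel_of_le ?_⟩
      rw [Finsupp.single_le_iff]
      omega
    simp [D, this]
  have hsum : Summable fun α => |coeff α (MvPowerSeries.pderiv ℝ i F)| * (ρ / 4) ^ α.degree := by
    have h := (hF.summable.mul_right ρ⁻¹).comp_injective hinj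
    refine Summable.of_nonneg_of_le (fun α => by positivity) (fun α => ?_) h
    have hb := hDbound (α + Finsupp.single i 1) (fun _ => ρ / 4) fun j => by
      rw [abs_of_pos (by positivity)]; linarith
    rw [hshift (fun _ => ρ / 4) α, abs_mul, Finset.prod_pow_eq_pow_sum, ← Finsupp.degree_eq_sum,
      abs_of_pos (a := (ρ / 4) ^ _) (by positivity)] at hb
    exact hb
  refine of_summable hsum fun x hx => ?_
  let line : ℝ → ι → ℝ := fun t => x + t • Pi.single i 1
  have hline : ∀ t ∈ Metric.ball (0 : ℝ) (ρ / 4), ∀ j, |line t j| ≤ ρ / 2 := by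
    intro t ht j
    rw [mem_ball_zero_iff, Real.norm_eq_abs] at ht
    have : |t * (Pi.single i (1 : ℝ) : ι → ℝ) j| ≤ |t| := by
      by_cases hj : j = i
      · subst hj; simp
      · simp [Pi.single_eq_of_ne hj]
    calc |line t j| ≤ |x j| + |t * (Pi.single i (1 : ℝ) : ι → ℝ) j| := abs_add_le _ _
      _ ≤ ρ / 4 + ρ / 4 := add_le_add (hx j) (this.trans ht.le)
      _ = ρ / 2 := by ring
  have hterm : ∀ α t, HasDerivAt (fun t => coeff α F * ∏ j, line t j ^ α j) (D α (line t)) t := by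
    intro α t
    have hl : ∀ t, ∏ j, line t j ^ α j =
        (x i + t) ^ α i * ∏ j ∈ Finset.univ.erase i, x j ^ α j := by
      intro t
      rw [← Finset.mul_prod_erase _ _ (Finset.mem_univ i)]
      congr 1
      · simp [line]
      · exact Finset.prod_congr rfl fun j hj => by
          simp [line, Pi.single_eq_of_ne (Finset.ne_of_mem_erase hj)]
    have hD : D α (line t) =
        coeff α F * (α i * (x i + t) ^ (α i - 1) * 1 * ∏ j ∈ Finset.univ.erase i, x j ^ α j) := by
      simp only [D]
      congr 2
      · simp [line]
      · exact Finset.prod_congr rfl fun j hj => by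
          simp [line, Pi.single_eq_of_ne (Finset.ne_of_mem_erase hj)]
    simp only [hl]
    rw [hD]
    exact ((((hasDerivAt_id t).const_add (x i)).pow (α i)).mul_const _).const_mul _
  have h0 : (0 : ℝ) ∈ Metric.ball (0 : ℝ) (ρ / 4) := Metric.mem_ball_self (by positivity)
  have hder := hasDerivAt_tsum_of_isPreconnected (hF.summable.mul_right ρ⁻¹) Metric.isOpen_ball
    (convex_ball (0 : ℝ) (ρ / 4)).isPreconnected (fun α t _ => hterm α t)
    (fun α t ht => hDbound α _ (hline t ht)) h0
    (hF.hasSum (line 0) fun j => (hline 0 h0 j).trans (by linarith)).summable h0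
  have heq : (fun t => ∑' α, coeff α F * ∏ j, line t j ^ α j) =ᶠ[nhds 0]
      fun t => φ (x + t • Pi.single i 1) := by
    filter_upwards [Metric.ball_mem_nhds (0 : ℝ) (show 0 < ρ / 4 by positivity)] with t ht
    exact (hF.hasSum (line t) fun j => (hline t ht j).trans (by linarith)).tsum_eq
  rw [lineDeriv, ← heq.deriv_eq, hder.deriv,
    ← hinj.tsum_eq (f := fun α => D α (line 0))]
  · refine tsum_congr fun β => ?_
    rw [hshift]
    simp only [line, zero_smul, add_zero]
  · intro α hα
    by_contra h
    exact hα (hrange _ α h)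

end HasSumOn

/-- The exponent of the monomial `∏ j, X (w j)` attached to the word `w`. -/
noncomputable def wordContent {ι : Type*} (w : Σ k : ℕ, Fin k → ι) : ι →₀ ℕ :=
  ∑ j, Finsupp.single (w.2 j) 1

theorem degree_wordContent {ι : Type*} (w : Σ k : ℕ, Fin k → ι) :
    (wordContent w).degree = w.1 := by
  simp [wordContent, map_sum]

theorem prod_pow_wordContent {ι : Type*} [Fintype ι] (w : Σ k : ℕ, Fin k → ι) (x : ι → ℝ) :
    ∏ i, x i ^ wordContent w i = ∏ j, x (w.2 j) := by
  classical
  simp only [wordContent, Finsupp.finsetSum_apply, ← Finset.prod_pow_eq_pow_sum]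
  rw [Finset.prod_comm]
  refine Finset.prod_congr rfl fun j _ => ?_
  rw [Finset.prod_eq_single (w.2 j)]
  · simp
  · intro i _ hi
    rw [Finsupp.single_eq_of_ne hi, pow_zero]
  · simp

theorem _root_.ContinuousMultilinearMap.apply_diag_eq_sum {ι : Type*} [Fintype ι] [DecidableEq ι]
    {k : ℕ} (p : ContinuousMultilinearMap ℝ (fun _ : Fin k => ι → ℝ) ℝ) (x : ι → ℝ) :
    p (fun _ => x) = ∑ w : Fin k → ι, p (fun j => Pi.single (w j) 1) * ∏ j, x (w j) := by
  have hx : x = ∑ i, x i • (Pi.single i 1 : ι → ℝ) := pi_eq_sum_univ' x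
  conv_lhs => rw [hx]
  rw [p.map_sum (fun (_ : Fin k) i => x i • (Pi.single i 1 : ι → ℝ))]
  refine Finset.sum_congr rfl fun w _ => ?_
  rw [p.map_smul_univ (fun j => x (w j)), smul_eq_mul, mul_comm]

/-- Collecting the terms with the same exponent in an absolutely convergent sum of monomials. -/
theorem hasSumOn_tsum_fiber {ι κ : Type*} [Fintype ι] {ρ : ℝ} (hρ : 0 < ρ) (c : κ → ι →₀ ℕ)
    (a : κ → ℝ) (hs : Summable fun w => |a w| * ρ ^ (c w).degree)
    {F : MvPowerSeries ι ℝ} (hF : ∀ α, coeff α F = ∑' w : {w // c w = α}, a w.1) :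
    HasSumOn ρ F (fun x => ∑' w, a w * ∏ i, x i ^ c w i) := by
  have hse : Summable fun v : Σ α, {w // c w = α} => |a v.2.1| * ρ ^ v.1.degree :=
    ((Equiv.sigmaFiberEquiv c).summable_iff.2 hs).congr fun v => by
      obtain ⟨_, w, rfl⟩ := v
      rfl
  refine HasSumOn.of_summable ?_ fun x hx => ?_
  · have h0 := hse.sigma
    dsimp only at h0
    refine Summable.of_nonneg_of_le (fun α => ?_) (fun α => ?_) h0
    · exact mul_nonneg (abs_nonneg _) (pow_nonneg hρ.le _)
    have h1 : Summable fun w : {w // c w = α} => |a w.1| * ρ ^ α.degree := by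
      simpa only using hse.sigma_factor α
    have h2 : Summable fun w : {w // c w = α} => |a w.1| :=
      (summable_mul_right_iff (a := ρ ^ α.degree) (pow_ne_zero _ hρ.ne')).1 h1
    have h3 := norm_tsum_le_tsum_norm (f := fun w : {w // c w = α} => a w.1) h2
    simp only [Real.norm_eq_abs] at h3
    rw [tsum_mul_right, hF]
    exact mul_le_mul_of_nonneg_right h3 (pow_nonneg hρ.le _)
  · have hsx : Summable fun v : Σ α, {w // c w = α} => a v.2.1 * ∏ i, x i ^ v.1 i := by
      refine Summable.of_norm_bounded hse fun v => ?_
      rw [Real.norm_eq_abs, abs_mul]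
      exact mul_le_mul_of_nonneg_left (prod_pow_le_pow_degree hx _) (abs_nonneg _)
    have h1 := (Equiv.sigmaFiberEquiv c).tsum_eq fun w => a w * ∏ i, x i ^ c w i
    rw [← h1]
    have h2 : ∀ v, a (Equiv.sigmaFiberEquiv c v) * ∏ i, x i ^ c (Equiv.sigmaFiberEquiv c v) i =
        a v.2.1 * ∏ i, x i ^ v.1 i := fun v => by
      obtain ⟨_, w, rfl⟩ := v
      rfl
    rw [tsum_congr h2, hsx.tsum_sigma]
    refine tsum_congr fun α => ?_
    rw [hF, ← tsum_mul_right]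

theorem exists_hasSumOn_of_analyticAt {ι : Type*} [Fintype ι] {h : (ι → ℝ) → ℝ}
    (hh : AnalyticAt ℝ h 0) : ∃ ρ > 0, ∃ F, HasSumOn ρ F h := by
  classical
  obtain ⟨p, R, hp⟩ := hh
  obtain ⟨r, hr0, hrR⟩ := ENNReal.lt_iff_exists_nnreal_btwn.1 hp.r_pos
  have hr : (0 : ℝ) < r := by exact_mod_cast hr0
  obtain ⟨C, hC, hbound⟩ := p.norm_le_div_pow_of_pos_of_lt_radius (by exact_mod_cast hr0)
    (hrR.trans_le hp.r_le)
  obtain ⟨n, hn⟩ : ∃ n : ℝ, n = Fintype.card ι := ⟨_, rfl⟩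
  have hn0 : 0 ≤ n := hn ▸ Nat.cast_nonneg _
  obtain ⟨ρ, hρr⟩ : ∃ ρ : ℝ, ρ = r / (2 * (n + 1)) := ⟨_, rfl⟩
  have hρ : 0 < ρ := hρr ▸ by positivity
  have hρlt : ρ < r := by
    rw [hρr, div_lt_iff₀ (by positivity)]; nlinarith
  have hρn : n * ρ / r ≤ 1 / 2 := by
    rw [hρr, div_le_iff₀ hr, mul_div_assoc', div_le_iff₀ (by positivity)]; nlinarith
  let a : (Σ k : ℕ, Fin k → ι) → ℝ := fun w => p w.1 fun j => Pi.single (w.2 j) 1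
  have ha : ∀ w, |a w| ≤ C / r ^ w.1 := fun w => by
    refine ((p w.1).le_opNorm _).trans ?_
    refine (mul_le_of_le_one_right (norm_nonneg _) ?_).trans (hbound _)
    refine Finset.prod_le_one (fun _ _ => norm_nonneg _) fun j _ => ?_
    rw [Pi.norm_single, norm_one]
  have hs : Summable fun w => |a w| * ρ ^ w.1 := by
    rw [summable_sigma_of_nonneg fun w => by positivity]
    refine ⟨fun k => Summable.of_finite, ?_⟩
    refine Summable.of_nonneg_of_le (fun k => tsum_nonneg fun w => by positivity) (fun k => ?_)
      (summable_geometric_two.mul_left C)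
    rw [tsum_fintype]
    calc _ ≤ ∑ w : Fin k → ι, C / r ^ k * ρ ^ k :=
          Finset.sum_le_sum fun w _ => mul_le_mul_of_nonneg_right (ha ⟨k, w⟩) (by positivity)
      _ = C * (n * ρ / r) ^ k := by
          rw [Finset.sum_const, Finset.card_univ, Fintype.card_pi, nsmul_eq_mul]
          simp only [Finset.prod_const, Finset.card_univ, Fintype.card_fin, Nat.cast_pow, ← hn]
          rw [div_pow, mul_pow]; ring
      _ ≤ C * (1 / 2) ^ k := by gcongr
  refine ⟨ρ, hρ, fun α => ∑' w : {w // wordContent w = α}, a w.1,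
    (hasSumOn_tsum_fiber hρ wordContent a (by simpa only [degree_wordContent] using hs)
      fun α => rfl).congr fun x hx => ?_⟩
  simp only [prod_pow_wordContent]
  have hsx : Summable fun w => a w * ∏ j, x (w.2 j) := by
    refine Summable.of_norm_bounded hs fun w => ?_
    rw [Real.norm_eq_abs, abs_mul]
    refine mul_le_mul_of_nonneg_left ?_ (abs_nonneg _)
    rw [← prod_pow_wordContent, ← degree_wordContent]
    exact prod_pow_le_pow_degree hx _
  rw [hsx.tsum_sigma]
  have hxR : x ∈ Metric.eball (0 : ι → ℝ) R := by
    rw [mem_eball_zero_iff]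
    refine lt_of_le_of_lt ?_ hrR
    have : ‖x‖ ≤ r := (pi_norm_le_iff_of_nonneg hr.le).2 fun i => (hx i).trans hρlt.le
    exact_mod_cast this
  have := (hp.hasSum hxR).tsum_eq
  rw [zero_add] at this
  rw [← this]
  refine tsum_congr fun k => ?_
  rw [tsum_fintype, ContinuousMultilinearMap.apply_diag_eq_sum]

end MvPowerSeries

/-- A triangular system whose off-diagonal part has norm at most `1 / 2` for a weighted `ℓ¹` norm
has a solution of finite norm. -/
theorem exists_summable_solution_of_triangular {A : Type*} {N : A → ℕ} {S : ℕ → Finset A}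
    (hN : Function.Injective N) (hS : ∀ α m, α ∈ S m ↔ N α < m) {g : A → A → ℝ} {w h : A → ℝ}
    (hw : ∀ α, 0 ≤ w α) (hg1 : ∀ α, g α α = 1) (hg0 : ∀ α β, N β < N α → g α β = 0)
    (hgs : ∀ α, Summable fun β => |g α β| * w β)
    (hgle : ∀ α, ∑' β, |g α β| * w β ≤ 3 / 2 * w α) (hh : Summable fun β => |h β| * w β) :
    ∃ c : A → ℝ, (Summable fun α => |c α| * w α) ∧
      (∀ β, h β = c β + ∑ α ∈ S (N β), c α * g α β) ∧
      ∀ β m, N β < m → h β = ∑ α ∈ S m, c α * g α β := by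
  classical
  obtain ⟨c, hc⟩ : ∃ c : A → ℝ, ∀ β, c β = h β - ∑ α ∈ S (N β), c α * g α β := by
    let step : ∀ β : A, (∀ α : A, N α < N β → ℝ) → ℝ := fun β ih =>
      h β - ∑ α ∈ (S (N β)).attach, ih α.1 ((hS _ _).1 α.2) * g α.1 β
    refine ⟨(measure N).wf.fix step, fun β => ?_⟩
    rw [WellFounded.fix_eq]
    simp only [step]
    rw [Finset.sum_attach (S (N β)) fun α => (measure N).wf.fix step α * g α β]
  have hsub : ∀ {β m}, N β < m → insert β (S (N β)) ⊆ S m := by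
    intro β m hβ α hα
    rcases Finset.mem_insert.1 hα with rfl | h
    · exact (hS _ _).2 hβ
    · exact (hS _ _).2 (((hS _ _).1 h).trans hβ)
  have hnot : ∀ β, β ∉ S (N β) := fun β hβ => lt_irrefl _ ((hS _ _).1 hβ)
  refine ⟨c, ?_, fun β => by rw [hc β]; ring, fun β m hβ => ?_⟩
  · have hA : ∀ m, ∑ β ∈ S m, |c β| * w β ≤ 2 * ∑' β, |h β| * w β := by
      intro m
      have h1 : ∀ β ∈ S m,
          2 * (|c β| * w β) ≤ |h β| * w β + ∑ α ∈ S m, |c α| * (|g α β| * w β) := by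
        intro β hβ
        have h2 : |c β| ≤ |h β| + ∑ α ∈ S (N β), |c α| * |g α β| := by
          conv_lhs => rw [hc β]
          refine (abs_sub _ _).trans (add_le_add_right ?_ _)
          refine (Finset.abs_sum_le_sum_abs _ _).trans (Finset.sum_le_sum fun α _ => ?_)
          rw [abs_mul]
        have h3 : |c β| + ∑ α ∈ S (N β), |c α| * |g α β| ≤ ∑ α ∈ S m, |c α| * |g α β| := by
          refine le_trans (le_of_eq ?_) (Finset.sum_le_sum_of_subset_of_nonneg
            (hsub ((hS _ _).1 hβ)) fun _ _ _ => by positivity)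
          rw [Finset.sum_insert (hnot β), hg1, abs_one, mul_one]
        simp only [← mul_assoc, ← Finset.sum_mul, ← add_mul]
        exact mul_le_mul_of_nonneg_right (by linarith) (hw β)
      have h4 := Finset.sum_le_sum h1
      rw [Finset.sum_add_distrib, Finset.sum_comm, ← Finset.mul_sum] at h4
      have h5 : ∑ α ∈ S m, ∑ β ∈ S m, |c α| * (|g α β| * w β) ≤
          3 / 2 * ∑ α ∈ S m, |c α| * w α := by
        rw [Finset.mul_sum]
        refine Finset.sum_le_sum fun α _ => ?_
        rw [← Finset.mul_sum, mul_left_comm]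
        refine mul_le_mul_of_nonneg_left (le_trans ?_ (hgle α)) (abs_nonneg _)
        exact (hgs α).sum_le_tsum _ fun β _ => mul_nonneg (abs_nonneg _) (hw β)
      have h6 := hh.sum_le_tsum (S m) fun β _ => mul_nonneg (abs_nonneg _) (hw β)
      linarith
    refine summable_of_sum_le (c := 2 * ∑' β, |h β| * w β)
      (fun α => mul_nonneg (abs_nonneg _) (hw α)) fun u => ?_
    refine (Finset.sum_le_sum_of_subset_of_nonneg (fun α hα => ?_)
      fun α _ _ => mul_nonneg (abs_nonneg _) (hw α)).trans (hA (u.sup N + 1))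
    exact (hS _ _).2 (Nat.lt_succ_of_le (Finset.le_sup hα))
  · rw [← Finset.sum_subset (hsub hβ), Finset.sum_insert (hnot β), hg1, hc β]
    · ring
    · intro α _ hα
      rw [hg0, mul_zero]
      rcases lt_trichotomy (N α) (N β) with h | h | h
      · exact absurd (Finset.mem_insert_of_mem ((hS _ _).2 h)) hα
      · exact absurd (Finset.mem_insert.2 (Or.inl (hN h))) hα
      · exact h

theorem Finsupp.exists_injective_multiplicative_enumeration (ι : Type*) [Fintype ι] :
    ∃ N : (ι →₀ ℕ) → ℕ, Function.Injective N ∧ (∀ α β, N (α + β) = N α * N β) ∧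
      (∀ α, 2 ^ α.degree ≤ N α) ∧ ∃ B : ℕ, 0 < B ∧ ∀ α, N α ≤ B ^ α.degree := by
  classical
  obtain ⟨p, hp⟩ : ∃ p : ι → Nat.Primes, Function.Injective p :=
    ⟨fun i => Infinite.natEmbedding Nat.Primes (Fintype.equivFin ι i), fun i j h => by
      simpa [Fin.val_inj] using h⟩
  have hp0 : ∀ i, (p i : ℕ) ≠ 0 := fun i => (p i).2.ne_zero
  refine ⟨fun α => ∏ i, (p i : ℕ) ^ α i, fun α β h => ?_, fun α β => ?_, fun α => ?_,
    ∏ i, (p i : ℕ), Finset.prod_pos fun i _ => (p i).2.pos, fun α => ?_⟩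
  · have hf : ∀ (α : ι →₀ ℕ) j, (∏ i, (p i : ℕ) ^ α i).factorization (p j) = α j := by
      intro α j
      rw [Nat.factorization_prod fun i _ => pow_ne_zero _ (hp0 i), Finsupp.finsetSum_apply,
        Finset.sum_eq_single j]
      · rw [(p j).2.factorization_pow, Finsupp.single_eq_same]
      · intro i _ hij
        rw [(p i).2.factorization_pow, Finsupp.single_eq_of_ne]
        exact fun h => hij (hp (Subtype.ext h.symm))
      · simp
    ext j
    rw [← hf α j, ← hf β j]
    exact congrArg (fun m => Nat.factorization m (p j)) h
  · simp only [Finsupp.add_apply, pow_add, Finset.prod_mul_distrib]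
  · rw [Finsupp.degree_eq_sum, ← Finset.prod_pow_eq_pow_sum]
    exact Finset.prod_le_prod' fun i _ => Nat.pow_le_pow_left (p i).2.two_le _
  · rw [Finsupp.degree_eq_sum, ← Finset.prod_pow_eq_pow_sum]
    exact Finset.prod_le_prod' fun i _ => Nat.pow_le_pow_left
      (Nat.le_of_dvd (Finset.prod_pos fun i _ => (p i).2.pos)
        (Finset.dvd_prod_of_mem _ (Finset.mem_univ i))) _

theorem Set.exists_finset_subset_forall_exists_le {A : Type*} [PartialOrder A]
    [WellQuasiOrderedLE A] (s : Set A) :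
    ∃ t : Finset A, (t : Set A) ⊆ s ∧ ∀ x ∈ s, ∃ a ∈ t, a ≤ x := by
  have hfin : {x | Minimal (· ∈ s) x}.Finite :=
    WellQuasiOrderedLE.finite_of_isAntichain (setOfPred_minimal_antichain (· ∈ s))
  refine ⟨hfin.toFinset, fun x hx => ?_, fun x hx => ?_⟩
  · exact (hfin.mem_toFinset.1 hx).prop
  · obtain ⟨a, hax, ha⟩ := exists_minimal_le_of_wellFoundedLT (· ∈ s) x hx
    exact ⟨a, hfin.mem_toFinset.2 ha, hax⟩

theorem eventually_tsum_mul_inv_pow_le {A : Type*} {N : A → ℕ} (hN0 : ∀ β, 0 < N β) {v : A → ℝ}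
    (hv : ∀ β, 0 ≤ v β) {a : A} (hva : v a = 1) (hv0 : ∀ β, β ≠ a → N β ≤ N a → v β = 0) {s : ℕ}
    (hs : Summable fun β => v β * ((N β : ℝ) ^ s)⁻¹) :
    ∀ᶠ σ : ℕ in Filter.atTop, (Summable fun β => v β * ((N β : ℝ) ^ σ)⁻¹) ∧
      ∑' β, v β * ((N β : ℝ) ^ σ)⁻¹ ≤ 3 / 2 * ((N a : ℝ) ^ σ)⁻¹ := by
  classical
  have hNr : ∀ β, (0 : ℝ) < N β := fun β => by exact_mod_cast hN0 β
  have hNr1 : ∀ β, (1 : ℝ) ≤ N β := fun β => by exact_mod_cast hN0 β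
  have hlim : Filter.Tendsto (fun σ : ℕ => ∑' β, v β * ((N a : ℝ) / N β) ^ σ) Filter.atTop
      (nhds (∑' β, if β = a then (1 : ℝ) else 0)) := by
    refine tendsto_tsum_of_dominated_convergence (hs.mul_right ((N a : ℝ) ^ s)) (fun β => ?_) ?_
    · by_cases hβ : β = a
      · subst hβ
        simp [hva, (hNr β).ne']
      · rw [if_neg hβ]
        rcases le_or_gt (N β) (N a) with h | h
        · simp [hv0 β hβ h]
        · have hlt : (N a : ℝ) / N β < 1 := by
            rw [div_lt_one (hNr β)]; exact_mod_cast h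
          simpa using (tendsto_pow_atTop_nhds_zero_of_lt_one (by positivity) hlt).const_mul (v β)
    · filter_upwards [Filter.eventually_ge_atTop s] with σ hσ β
      rw [Real.norm_of_nonneg (mul_nonneg (hv β) (by positivity)), mul_assoc]
      by_cases hβ : v β = 0
      · simp [hβ]
      refine mul_le_mul_of_nonneg_left ?_ (hv β)
      have hle : (N a : ℝ) / N β ≤ 1 := by
        rw [div_le_one (hNr β)]
        by_contra! h
        rcases eq_or_ne β a with rfl | hne
        · exact lt_irrefl _ h
        · exact hβ (hv0 β hne (by exact_mod_cast h.le))
      refine (pow_le_pow_of_le_one (by positivity) hle hσ).trans_eq ?_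
      rw [div_pow, div_eq_inv_mul]
  rw [tsum_ite_eq] at hlim
  filter_upwards [hlim.eventually_lt_const (show (1 : ℝ) < 3 / 2 by norm_num),
    Filter.eventually_ge_atTop s] with σ hσ hsσ
  constructor
  · refine Summable.of_nonneg_of_le (fun β => mul_nonneg (hv β) (by positivity)) (fun β => ?_) hs
    exact mul_le_mul_of_nonneg_left (inv_anti₀ (pow_pos (hNr β) _)
      (pow_le_pow_right₀ (hNr1 β) hsσ)) (hv β)
  · have h : ∀ β, v β * ((N β : ℝ) ^ σ)⁻¹ =
        v β * ((N a : ℝ) / N β) ^ σ * ((N a : ℝ) ^ σ)⁻¹ := fun β => by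
      have := (pow_pos (hNr a) σ).ne'
      rw [div_pow]
      field_simp
    rw [tsum_congr h, tsum_mul_right]
    exact mul_le_mul_of_nonneg_right hσ.le (by positivity)

namespace MvPowerSeries

theorem HasSumOn.abs_le {ι : Type*} [Fintype ι] {ρ : ℝ} {F : MvPowerSeries ι ℝ}
    {φ : (ι → ℝ) → ℝ} (h : HasSumOn ρ F φ) {x : ι → ℝ} (hx : ∀ i, |x i| ≤ ρ) :
    |φ x| ≤ ∑' α, |coeff α F| * ρ ^ α.degree := by
  rw [← (h.hasSum x hx).tsum_eq, ← Real.norm_eq_abs]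
  refine tsum_of_norm_bounded h.summable.hasSum fun α => ?_
  rw [Real.norm_eq_abs, abs_mul]
  exact mul_le_mul_of_nonneg_left (prod_pow_le_pow_degree hx α) (abs_nonneg _)

theorem exists_hasSumOn_coe {ι : Type*} [Fintype ι] {ρ : ℝ} (hρ : 0 ≤ ρ) (p : MvPolynomial ι ℝ) :
    ∃ φ, HasSumOn ρ (p : MvPowerSeries ι ℝ) φ := by
  induction p using MvPolynomial.induction_on' with
  | monomial α c =>
    rw [MvPolynomial.coe_monomial]
    exact ⟨_, HasSumOn.monomial α c⟩
  | add p q hp hq =>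
    obtain ⟨φ, hφ⟩ := hp
    obtain ⟨ψ, hψ⟩ := hq
    rw [MvPolynomial.coe_add]
    exact ⟨_, hφ.add hρ hψ⟩

theorem exists_hasSumOn_of_mem_span {ι κ : Type*} [Fintype ι] [Fintype κ] {ρ : ℝ} (hρ : 0 ≤ ρ)
    {F : κ → MvPowerSeries ι ℝ} {f : κ → (ι → ℝ) → ℝ} (hF : ∀ k, HasSumOn ρ (F k) (f k))
    {g : MvPowerSeries ι ℝ} (hg : g ∈ Submodule.span (MvPolynomial ι ℝ) (Set.range F)) :
    ∃ φ, HasSumOn ρ g φ ∧ ∃ C, 0 ≤ C ∧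
      ∀ x : ι → ℝ, (∀ i, |x i| ≤ ρ) → |φ x| ≤ C * ∑ k, |f k x| := by
  induction hg using Submodule.span_induction with
  | mem g hg =>
    obtain ⟨k, rfl⟩ := hg
    refine ⟨f k, hF k, 1, zero_le_one, fun x _ => ?_⟩
    rw [one_mul]
    exact Finset.single_le_sum (f := fun k => |f k x|) (fun _ _ => abs_nonneg _)
      (Finset.mem_univ k)
  | zero =>
    refine ⟨fun _ => 0, ?_, 0, le_rfl, fun x _ => by simp⟩
    simpa using HasSumOn.monomial (ρ := ρ) (0 : ι →₀ ℕ) 0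
  | add g g' _ _ h h' =>
    obtain ⟨φ, hφ, C, hC, hle⟩ := h
    obtain ⟨φ', hφ', C', hC', hle'⟩ := h'
    refine ⟨φ + φ', hφ.add hρ hφ', C + C', add_nonneg hC hC', fun x hx => ?_⟩
    rw [add_mul]
    exact (abs_add_le _ _).trans (add_le_add (hle x hx) (hle' x hx))
  | smul p g _ h =>
    obtain ⟨φ, hφ, C, hC, hle⟩ := h
    obtain ⟨ψ, hψ⟩ := exists_hasSumOn_coe hρ p
    have hp : p • g = (p : MvPowerSeries ι ℝ) * g := by
      rw [Algebra.smul_def]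
      simp [algebraMap_apply']
    rw [hp]
    refine ⟨ψ * φ, hψ.mul hρ hφ, (∑' α, |coeff α (p : MvPowerSeries ι ℝ)| * ρ ^ α.degree) * C,
      mul_nonneg (tsum_nonneg fun α => mul_nonneg (abs_nonneg _) (pow_nonneg hρ _)) hC,
      fun x hx => ?_⟩
    rw [Pi.mul_apply, abs_mul, mul_assoc]
    exact mul_le_mul (hψ.abs_le hx) (hle x hx) (abs_nonneg _)
      (tsum_nonneg fun α => mul_nonneg (abs_nonneg _) (pow_nonneg hρ _))

/-- Multiplying a power series by a monomial shifts a weighted sum of its coefficients. -/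
theorem hasSum_coeff_monomial_mul {ι : Type*} (γ : ι →₀ ℕ) {g : MvPowerSeries ι ℝ}
    {v : ℝ → (ι →₀ ℕ) → ℝ} (hv : ∀ β, v 0 β = 0) {s : ℝ}
    (h : HasSum (fun β => v (coeff β g) (γ + β)) s) :
    HasSum (fun β => v (coeff β (monomial γ 1 * g)) β) s := by
  classical
  have hinj : Function.Injective fun β : ι →₀ ℕ => γ + β := add_right_injective γ
  rw [← hinj.hasSum_iff]
  · refine h.congr_fun fun β => ?_
    rw [Function.comp_apply, coeff_add_monomial_mul, one_mul]
  · intro β hβ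
    rw [coeff_monomial_mul, if_neg, hv]
    intro hle
    exact hβ ⟨β - γ, add_tsub_cancel_of_le hle⟩

end MvPowerSeries

theorem abs_tsum_mul_le_of_triangular {A : Type*} {N : A → ℕ} {S : ℕ → Finset A}
    (hS : ∀ α m, α ∈ S m ↔ N α < m) {g : A → A → ℝ} {w h c y : A → ℝ} {B T : ℝ}
    (hg0 : ∀ α β, N β < N α → g α β = 0)
    (hgs : ∀ α, Summable fun β => |g α β| * w β) (hgle : ∀ α, ∑' β, |g α β| * w β ≤ B * w α)
    (hcs : Summable fun α => |c α| * w α)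
    (hc : ∀ β m, N β < m → h β = ∑ α ∈ S m, c α * g α β)
    (hy : ∀ β, |y β| ≤ w β) (hT : ∀ α, c α ≠ 0 → |∑' β, g α β * y β| ≤ w α * T) :
    |∑' β, h β * y β| ≤ (∑' α, |c α| * w α) * T := by
  have hw : ∀ β, 0 ≤ w β := fun β => (abs_nonneg _).trans (hy β)
  have hK0 : Summable fun p : A × A => |c p.1| * (|g p.1 p.2| * w p.2) := by
    rw [summable_prod_of_nonneg fun p =>
      mul_nonneg (abs_nonneg _) (mul_nonneg (abs_nonneg _) (hw _))]
    refine ⟨fun α => by simpa only using (hgs α).mul_left |c α|, ?_⟩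
    dsimp only
    refine Summable.of_nonneg_of_le (fun α => tsum_nonneg fun β =>
      mul_nonneg (abs_nonneg _) (mul_nonneg (abs_nonneg _) (hw _))) (fun α => ?_) (hcs.mul_left B)
    rw [tsum_mul_left, mul_left_comm]
    exact mul_le_mul_of_nonneg_left (hgle α) (abs_nonneg _)
  have hK : Summable fun p : A × A => c p.1 * (g p.1 p.2 * y p.2) := by
    refine Summable.of_norm_bounded hK0 fun p => ?_
    rw [Real.norm_eq_abs, abs_mul, abs_mul]
    exact mul_le_mul_of_nonneg_left (mul_le_mul_of_nonneg_left (hy _) (abs_nonneg _))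
      (abs_nonneg _)
  have h1 : ∀ β, h β * y β = ∑' α, c α * (g α β * y β) := by
    intro β
    rw [tsum_eq_sum (s := S (N β + 1)), hc β _ (Nat.lt_succ_self _), Finset.sum_mul]
    · exact Finset.sum_congr rfl fun α _ => mul_assoc _ _ _
    · intro α hα
      rw [hg0 α β, zero_mul, mul_zero]
      by_contra hlt
      exact hα ((hS _ _).2 (Nat.lt_succ_of_le (not_lt.1 hlt)))
  have h2 : ∑' β, h β * y β = ∑' α, c α * ∑' β, g α β * y β := by
    rw [tsum_congr h1, Summable.tsum_comm (f := fun α β => c α * (g α β * y β)) hK]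
    exact tsum_congr fun α => tsum_mul_left
  rw [h2, ← Real.norm_eq_abs]
  refine tsum_of_norm_bounded (hcs.hasSum.mul_right T) fun α => ?_
  rw [Real.norm_eq_abs, abs_mul, mul_assoc]
  by_cases hα : c α = 0
  · simp [hα]
  · exact mul_le_mul_of_nonneg_left (hT α hα) (abs_nonneg _)

namespace MvPowerSeries

/-- The initial exponents of a set of power series, for the order of exponents given by `N`. -/
def initialExponents {ι : Type*} (N : (ι →₀ ℕ) → ℕ) (I : Set (MvPowerSeries ι ℝ)) :
    Set (ι →₀ ℕ) :=
  {α | ∃ g ∈ I, coeff α g = 1 ∧ ∀ β, N β < N α → coeff β g = 0}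

theorem eq_zero_of_notMem_initialExponents {ι : Type*} {N : (ι →₀ ℕ) → ℕ}
    (hN2 : ∀ α, 2 ^ α.degree ≤ N α) {S : ℕ → Finset (ι →₀ ℕ)} (hS : ∀ α m, α ∈ S m ↔ N α < m)
    {I : Submodule (MvPolynomial ι ℝ) (MvPowerSeries ι ℝ)} {H : MvPowerSeries ι ℝ}
    (hH : ∀ M, ∃ g ∈ I, H - g ∈ degreeGE ι ℝ M) {G : (ι →₀ ℕ) → MvPowerSeries ι ℝ}
    (hG : ∀ α ∈ initialExponents N I, G α ∈ I) {c : (ι →₀ ℕ) → ℝ}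
    (hc1 : ∀ β, coeff β H = c β + ∑ α ∈ S (N β), c α * coeff β (G α))
    (hc2 : ∀ β m, N β < m → coeff β H = ∑ α ∈ S m, c α * coeff β (G α))
    (α : ι →₀ ℕ) (hα : α ∉ initialExponents N I) : c α = 0 := by
  classical
  induction hm : N α using Nat.strong_induction_on generalizing α with
  | _ m ih =>
    subst hm
    by_contra hcα
    obtain ⟨g, hgI, hg⟩ := hH (N α + 1)
    rw [mem_degreeGE] at hg
    have hcoeff : ∀ β, N β ≤ N α → coeff β g = coeff β H := by
      intro β hβ
      have hdeg : β.degree < N α + 1 :=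
        (Nat.lt_two_pow_self.trans_le ((hN2 β).trans hβ)).trans (Nat.lt_succ_self _)
      have := hg β hdeg
      rw [map_sub, sub_eq_zero] at this
      exact this.symm
    have hsmul : ∀ (r : ℝ) (G : MvPowerSeries ι ℝ), G ∈ I → r • G ∈ I := by
      intro r G hGI
      have : r • G = (MvPolynomial.C r : MvPolynomial ι ℝ) • G := by
        rw [Algebra.smul_def, Algebra.smul_def]
        simp [algebraMap_apply', algebraMap_apply]
      rw [this]
      exact I.smul_mem _ hGI
    have hsum : ∑ β ∈ S (N α), c β • G β ∈ I := by
      refine sum_mem fun β hβ => ?_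
      by_cases hβI : β ∈ initialExponents N I
      · exact hsmul _ _ (hG β hβI)
      · rw [ih (N β) ((hS _ _).1 hβ) β hβI rfl, zero_smul]
        exact zero_mem _
    have hcs : ∀ β, N β ≤ N α → coeff β ((c α)⁻¹ • (g - ∑ β ∈ S (N α), c β • G β)) =
        (c α)⁻¹ * (coeff β H - ∑ γ ∈ S (N α), c γ * coeff β (G γ)) := by
      intro β hβ
      simp only [map_smul, map_sub, map_sum, smul_eq_mul, hcoeff β hβ]
    refine hα ⟨_, hsmul (c α)⁻¹ _ (sub_mem hgI hsum), ?_, fun β hβ => ?_⟩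
    · rw [hcs α le_rfl, hc1 α, add_sub_cancel_right, inv_mul_cancel₀ hcα]
    · rw [hcs β hβ.le, hc2 β _ hβ, sub_self, mul_zero]

theorem exists_weight_and_standard_family {ι : Type*} [Fintype ι] {N : (ι →₀ ℕ) → ℕ}
    (hNi : Function.Injective N) (hNm : ∀ α β, N (α + β) = N α * N β)
    (hN2 : ∀ α, 2 ^ α.degree ≤ N α) {ρ : ℝ} (hρ : 0 < ρ)
    {I : Submodule (MvPolynomial ι ℝ) (MvPowerSeries ι ℝ)} {T : (ι → ℝ) → ℝ}
    (hT : ∀ x, 0 ≤ T x)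
    (hI : ∀ g ∈ I, ∃ φ, HasSumOn ρ g φ ∧ ∃ C, 0 ≤ C ∧
      ∀ x : ι → ℝ, (∀ i, |x i| ≤ ρ) → |φ x| ≤ C * T x) :
    ∃ σ : ℕ, (1 / 2 : ℝ) ^ σ ≤ ρ ∧ ∃ (K : ℝ) (G : (ι →₀ ℕ) → MvPowerSeries ι ℝ), ∀ α,
      coeff α (G α) = 1 ∧ (∀ β, N β < N α → coeff β (G α) = 0) ∧
      (Summable fun β => |coeff β (G α)| * ((N β : ℝ) ^ σ)⁻¹) ∧
      ∑' β, |coeff β (G α)| * ((N β : ℝ) ^ σ)⁻¹ ≤ 3 / 2 * ((N α : ℝ) ^ σ)⁻¹ ∧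
      (α ∈ initialExponents N I → G α ∈ I ∧ ∀ x : ι → ℝ, (∀ i, |x i| ≤ ρ) →
        (∀ β : ι →₀ ℕ, |∏ i, x i ^ β i| ≤ ((N β : ℝ) ^ σ)⁻¹) →
        |∑' β, coeff β (G α) * ∏ i, x i ^ β i| ≤ ((N α : ℝ) ^ σ)⁻¹ * (K * T x)) := by
  classical
  have hN0 : ∀ α, 0 < N α := fun α => (Nat.two_pow_pos _).trans_le (hN2 α)
  have hNr : ∀ α, (0 : ℝ) < N α := fun α => by exact_mod_cast hN0 α
  obtain ⟨t, htI, ht⟩ := Set.exists_finset_subset_forall_exists_le (initialExponents N I)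
  have hex : ∀ a ∈ initialExponents N I, ∃ g ∈ I, coeff a g = 1 ∧
      (∀ β, N β < N a → coeff β g = 0) ∧ ∃ φ C, HasSumOn ρ g φ ∧ 0 ≤ C ∧
        ∀ x : ι → ℝ, (∀ i, |x i| ≤ ρ) → |φ x| ≤ C * T x := by
    rintro a ⟨g, hgI, hg1, hg0⟩
    obtain ⟨φ, hφ, C, hC, hle⟩ := hI g hgI
    exact ⟨g, hgI, hg1, hg0, φ, C, hφ, hC, hle⟩
  choose! g hgI hg1 hg0 φ C hφ hC hle using hex
  obtain ⟨s, hs⟩ := exists_pow_lt_of_lt_one hρ (show (1 / 2 : ℝ) < 1 by norm_num)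
  have hws : ∀ β, ((N β : ℝ) ^ s)⁻¹ ≤ ρ ^ β.degree := by
    intro β
    calc ((N β : ℝ) ^ s)⁻¹ ≤ (((2 : ℝ) ^ β.degree) ^ s)⁻¹ := by
          have : (2 : ℝ) ^ β.degree ≤ N β := by exact_mod_cast hN2 β
          gcongr
      _ = ((1 / 2 : ℝ) ^ s) ^ β.degree := by
          rw [← pow_mul, ← pow_mul, mul_comm s, one_div, inv_pow]
      _ ≤ ρ ^ β.degree := pow_le_pow_left₀ (by positivity) hs.le _
  have hev : ∀ a ∈ t, ∀ᶠ σ : ℕ in Filter.atTop,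
      (Summable fun β => |coeff β (g a)| * ((N β : ℝ) ^ σ)⁻¹) ∧
        ∑' β, |coeff β (g a)| * ((N β : ℝ) ^ σ)⁻¹ ≤ 3 / 2 * ((N a : ℝ) ^ σ)⁻¹ := by
    intro a ha
    have haI := htI ha
    refine eventually_tsum_mul_inv_pow_le (s := s) hN0 (fun β => abs_nonneg (coeff β (g a)))
      (by rw [hg1 a haI, abs_one]) (fun β hβ hle => ?_) ?_
    · rw [hg0 a haI β (lt_of_le_of_ne hle fun h => hβ (hNi h)), abs_zero]
    · exact Summable.of_nonneg_of_le (fun β => mul_nonneg (abs_nonneg _) (by positivity))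
        (fun β => mul_le_mul_of_nonneg_left (hws β) (abs_nonneg _)) (hφ a haI).summable
  obtain ⟨σ, hσt, hσs⟩ := (((Finset.eventually_all t).2 hev).and
    (Filter.eventually_ge_atTop s)).exists
  refine ⟨σ, (pow_le_pow_of_le_one (by norm_num) (by norm_num) hσs).trans hs.le,
    ∑ a ∈ t, C a * (N a : ℝ) ^ σ, ?_⟩
  set K := ∑ a ∈ t, C a * (N a : ℝ) ^ σ with hKdef
  have hK : ∀ a ∈ t, C a ≤ ((N a : ℝ) ^ σ)⁻¹ * K := by
    intro a ha
    rw [← div_eq_inv_mul, le_div_iff₀ (pow_pos (hNr a) _)]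
    exact Finset.single_le_sum (f := fun a => C a * (N a : ℝ) ^ σ)
      (fun b hb => mul_nonneg (hC b (htI hb)) (by positivity)) ha
  have hw : ∀ α β, ((N (α + β) : ℝ) ^ σ)⁻¹ = ((N α : ℝ) ^ σ)⁻¹ * ((N β : ℝ) ^ σ)⁻¹ := by
    intro α β
    rw [hNm, Nat.cast_mul, mul_pow, mul_inv]
  suffices hex : ∀ α, ∃ G : MvPowerSeries ι ℝ, coeff α G = 1 ∧ (∀ β, N β < N α → coeff β G = 0) ∧
      (Summable fun β => |coeff β G| * ((N β : ℝ) ^ σ)⁻¹) ∧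
      ∑' β, |coeff β G| * ((N β : ℝ) ^ σ)⁻¹ ≤ 3 / 2 * ((N α : ℝ) ^ σ)⁻¹ ∧
      (α ∈ initialExponents N I → G ∈ I ∧ ∀ x : ι → ℝ, (∀ i, |x i| ≤ ρ) →
        (∀ β : ι →₀ ℕ, |∏ i, x i ^ β i| ≤ ((N β : ℝ) ^ σ)⁻¹) →
        |∑' β, coeff β G * ∏ i, x i ^ β i| ≤ ((N α : ℝ) ^ σ)⁻¹ * (K * T x)) by
    choose G hG using hex
    exact ⟨G, hG⟩
  intro α
  by_cases hα : α ∈ initialExponents N I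
  · obtain ⟨a, hat, haα⟩ := ht α hα
    have haI := htI hat
    obtain ⟨γ, rfl⟩ : ∃ γ, α = γ + a := ⟨α - a, (tsub_add_cancel_of_le haα).symm⟩
    have hsum := hasSum_coeff_monomial_mul γ (g := g a)
      (v := fun r β => |r| * ((N β : ℝ) ^ σ)⁻¹) (fun β => by simp)
      (((hσt a hat).1.hasSum.mul_left ((N γ : ℝ) ^ σ)⁻¹).congr_fun fun β => by
        rw [hw, mul_left_comm])
    refine ⟨monomial γ 1 * g a, ?_, fun β hβ => ?_, hsum.summable, ?_, fun _ => ⟨?_, ?_⟩⟩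
    · rw [coeff_add_monomial_mul, hg1 a haI, one_mul]
    · rw [coeff_monomial_mul]
      split_ifs with hle
      · obtain ⟨δ, rfl⟩ := exists_add_of_le hle
        rw [hNm, hNm] at hβ
        rw [add_tsub_cancel_left, hg0 a haI δ (lt_of_mul_lt_mul_left hβ (Nat.zero_le _)), mul_zero]
      · rfl
    · rw [hsum.tsum_eq, hw, mul_left_comm]
      exact mul_le_mul_of_nonneg_left (hσt a hat).2 (by positivity)
    · have : (monomial γ (1 : ℝ) : MvPowerSeries ι ℝ) * g a =
          (MvPolynomial.monomial γ (1 : ℝ)) • g a := by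
        rw [Algebra.smul_def]
        simp [algebraMap_apply']
      rw [this]
      exact I.smul_mem _ (hgI a haI)
    · intro x hx hxw
      have hval := hasSum_coeff_monomial_mul γ (g := g a)
        (v := fun r β => r * ∏ i, x i ^ β i) (fun β => by simp)
        ((((hφ a haI).hasSum x hx).mul_left (∏ i, x i ^ γ i)).congr_fun fun β => by
          simp only [Finsupp.add_apply, pow_add, Finset.prod_mul_distrib]
          ring)
      rw [hval.tsum_eq, abs_mul, hw, mul_assoc]
      refine mul_le_mul (hxw γ) ((hle a haI x hx).trans ?_) (abs_nonneg _) (by positivity)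
      rw [← mul_assoc]
      exact mul_le_mul_of_nonneg_right (hK a hat) (hT x)
  · have hsum : HasSum (fun β => |coeff β (monomial α (1 : ℝ))| * ((N β : ℝ) ^ σ)⁻¹)
        (((N α : ℝ) ^ σ)⁻¹) := by
      have := hasSum_single (f := fun β => |coeff β (monomial α (1 : ℝ))| * ((N β : ℝ) ^ σ)⁻¹) α
        fun β hβ => by rw [coeff_monomial_ne hβ]; simp
      simpa using this
    refine ⟨monomial α 1, coeff_monomial_same _ _, fun β hβ => ?_, hsum.summable, ?_,
      fun h => absurd h hα⟩
    · exact coeff_monomial_ne (fun h => hβ.ne (congrArg N h)) _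
    · rw [hsum.tsum_eq]
      have : 0 ≤ ((N α : ℝ) ^ σ)⁻¹ := by positivity
      linarith

theorem exists_abs_le_mul_sum_of_approx {ι κ : Type*} [Fintype ι] [Fintype κ] {ρ : ℝ} (hρ : 0 < ρ)
    {F : κ → MvPowerSeries ι ℝ} {f : κ → (ι → ℝ) → ℝ} (hF : ∀ k, HasSumOn ρ (F k) (f k))
    {H : MvPowerSeries ι ℝ} {h : (ι → ℝ) → ℝ} (hH : HasSumOn ρ H h)
    (happ : ∀ M, ∃ g ∈ Submodule.span (MvPolynomial ι ℝ) (Set.range F), H - g ∈ degreeGE ι ℝ M) :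
    ∃ C, 0 ≤ C ∧ ∃ δ > 0, ∀ x : ι → ℝ, (∀ i, |x i| ≤ δ) → |h x| ≤ C * ∑ k, |f k x| := by
  obtain ⟨N, hNi, hNm, hN2, B, hB, hNB⟩ := Finsupp.exists_injective_multiplicative_enumeration ι
  have hT : ∀ x : ι → ℝ, 0 ≤ ∑ k, |f k x| := fun x => Finset.sum_nonneg fun k _ => abs_nonneg _
  obtain ⟨σ, hσ, K, G, hG⟩ := exists_weight_and_standard_family hNi hNm hN2 hρ
    (I := Submodule.span (MvPolynomial ι ℝ) (Set.range F)) (T := fun x => ∑ k, |f k x|) hT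
    fun g hg => exists_hasSumOn_of_mem_span hρ.le hF hg
  have hNr : ∀ α, (0 : ℝ) < N α := fun α => by
    exact_mod_cast (Nat.two_pow_pos _).trans_le (hN2 α)
  have hBr : (0 : ℝ) < B := by exact_mod_cast hB
  let S : ℕ → Finset (ι →₀ ℕ) := fun m => ((Set.finite_Iio m).preimage hNi.injOn).toFinset
  have hS : ∀ α m, α ∈ S m ↔ N α < m := fun α m => by simp [S]
  have hwρ : ∀ β, ((N β : ℝ) ^ σ)⁻¹ ≤ ρ ^ β.degree := by
    intro β
    calc ((N β : ℝ) ^ σ)⁻¹ ≤ (((2 : ℝ) ^ β.degree) ^ σ)⁻¹ := by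
          have : (2 : ℝ) ^ β.degree ≤ N β := by exact_mod_cast hN2 β
          gcongr
      _ = ((1 / 2 : ℝ) ^ σ) ^ β.degree := by
          rw [← pow_mul, ← pow_mul, mul_comm σ, one_div, inv_pow]
      _ ≤ ρ ^ β.degree := pow_le_pow_left₀ (by positivity) hσ _
  have hwB : ∀ β : ι →₀ ℕ, (((B : ℝ) ^ σ)⁻¹) ^ β.degree ≤ ((N β : ℝ) ^ σ)⁻¹ := by
    intro β
    have hle : (N β : ℝ) ≤ (B : ℝ) ^ β.degree := by exact_mod_cast hNB β
    have := hNr β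
    calc (((B : ℝ) ^ σ)⁻¹) ^ β.degree = (((B : ℝ) ^ β.degree) ^ σ)⁻¹ := by
          rw [inv_pow, ← pow_mul, ← pow_mul, mul_comm σ]
      _ ≤ ((N β : ℝ) ^ σ)⁻¹ := by gcongr
  have hHs : Summable fun β => |coeff β H| * ((N β : ℝ) ^ σ)⁻¹ :=
    Summable.of_nonneg_of_le (fun β => mul_nonneg (abs_nonneg _) (by positivity))
      (fun β => mul_le_mul_of_nonneg_left (hwρ β) (abs_nonneg _)) hH.summable
  obtain ⟨c, hcs, hc1, hc2⟩ := exists_summable_solution_of_triangular hNi hS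
    (g := fun α β => coeff β (G α)) (w := fun β => ((N β : ℝ) ^ σ)⁻¹) (h := fun β => coeff β H)
    (fun β => by positivity) (fun α => (hG α).1) (fun α β => (hG α).2.1 β)
    (fun α => (hG α).2.2.1) (fun α => (hG α).2.2.2.1) hHs
  have hc0 : ∀ α, c α ≠ 0 →
      α ∈ initialExponents N (Submodule.span (MvPolynomial ι ℝ) (Set.range F)) := by
    intro α hα
    by_contra hmem
    exact hα (eq_zero_of_notMem_initialExponents hN2 hS happ
      (fun β hβ => ((hG β).2.2.2.2 hβ).1) hc1 hc2 α hmem)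
  have hC : 0 ≤ ∑' α, |c α| * ((N α : ℝ) ^ σ)⁻¹ :=
    tsum_nonneg fun α => mul_nonneg (abs_nonneg _) (by positivity)
  refine ⟨(∑' α, |c α| * ((N α : ℝ) ^ σ)⁻¹) * |K|, mul_nonneg hC (abs_nonneg _),
    min ρ ((B : ℝ) ^ σ)⁻¹, lt_min hρ (by positivity), fun x hx => ?_⟩
  have hxρ : ∀ i, |x i| ≤ ρ := fun i => (hx i).trans (min_le_left _ _)
  have hxw : ∀ β : ι →₀ ℕ, |∏ i, x i ^ β i| ≤ ((N β : ℝ) ^ σ)⁻¹ := fun β =>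
    (prod_pow_le_pow_degree (fun i => (hx i).trans (min_le_right _ _)) β).trans (hwB β)
  have key := abs_tsum_mul_le_of_triangular hS (g := fun α β => coeff β (G α))
    (w := fun β => ((N β : ℝ) ^ σ)⁻¹) (h := fun β => coeff β H) (y := fun β => ∏ i, x i ^ β i)
    (T := K * ∑ k, |f k x|) (fun α β => (hG α).2.1 β) (fun α => (hG α).2.2.1)
    (fun α => (hG α).2.2.2.1) hcs hc2 hxw
    fun α hα => ((hG α).2.2.2.2 (hc0 α hα)).2 x hxρ hxw
  rw [← (hH.hasSum x hxρ).tsum_eq, mul_assoc]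
  exact key.trans (mul_le_mul_of_nonneg_left
    (mul_le_mul_of_nonneg_right (le_abs_self K) (hT x)) hC)

end MvPowerSeries

theorem Finite.exists_pos_forall_le {ι : Type*} [Finite ι] {r : ι → ℝ} (hr : ∀ i, 0 < r i) :
    ∃ s > 0, ∀ i, s ≤ r i := by
  obtain ⟨s, hs⟩ := Finite.exists_ge fun i => (⟨r i, hr i⟩ : Set.Ioi (0 : ℝ))
  exact ⟨s, s.2, hs⟩

theorem lineDeriv_coord_comp_toLp {n : ℕ} {f : EuclideanSpace ℝ (Fin n) → EuclideanSpace ℝ (Fin n)}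
    {x : EuclideanSpace ℝ (Fin n)} (hf : DifferentiableAt ℝ f x) (i j : Fin n) :
    lineDeriv ℝ (fun y => f (WithLp.toLp 2 y) j) x.ofLp (Pi.single i 1) =
      fderiv ℝ f x (EuclideanSpace.single i 1) j := by
  have h1 : HasFDerivAt f (fderiv ℝ f x) ((EuclideanSpace.equiv (Fin n) ℝ).symm x.ofLp) :=
    hf.hasFDerivAt
  have h2 := h1.comp x.ofLp (EuclideanSpace.equiv (Fin n) ℝ).symm.hasFDerivAt
  have h3 := (EuclideanSpace.proj (𝕜 := ℝ) j).hasFDerivAt.comp x.ofLp h2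
  exact (h3.hasLineDerivAt (Pi.single i 1)).lineDeriv

theorem EuclideanSpace.norm_le_sum_abs {n : ℕ} (x : EuclideanSpace ℝ (Fin n)) :
    ‖x‖ ≤ ∑ i, |x i| := by
  rw [EuclideanSpace.norm_eq]
  refine Real.sqrt_le_iff.2 ⟨Finset.sum_nonneg fun i _ => abs_nonneg _, ?_⟩
  exact Finset.sum_sq_le_sq_sum_of_nonneg fun i _ => abs_nonneg _

/-- A coordinate times the Jacobian determinant is bounded by the sum of the components. -/
theorem exists_abs_coord_mul_det_lineDeriv_le {ι : Type*} [Fintype ι] [DecidableEq ι]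
    {g : ι → (ι → ℝ) → ℝ} (hg : ∀ j, AnalyticAt ℝ (g j) 0) (i : ι) :
    ∃ C, 0 ≤ C ∧ ∃ δ > 0, ∀ x : ι → ℝ, (∀ i, |x i| ≤ δ) →
      |x i| * |(Matrix.of fun j i => lineDeriv ℝ (g j) x (Pi.single i 1)).det| ≤
        C * ∑ j, |g j x| := by
  choose r hr F hF using fun j => MvPowerSeries.exists_hasSumOn_of_analyticAt (hg j)
  obtain ⟨ρ, hρ, hle⟩ : ∃ ρ > 0, ∀ j, ρ ≤ r j :=
    Finite.exists_pos_forall_le hr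
  have hFρ : ∀ j, MvPowerSeries.HasSumOn ρ (F j) (g j) := fun j => (hF j).mono hρ.le (hle j)
  have hρ4 : 0 < ρ / 4 := by positivity
  have hdet := MvPowerSeries.HasSumOn.det hρ4.le
    (M := Matrix.of fun j i => MvPowerSeries.pderiv ℝ i (F j)) fun j i => (hFρ j).pderiv hρ i
  have hmul := (MvPowerSeries.HasSumOn.monomial (Finsupp.single i 1) (1 : ℝ)).mul hρ4.le hdet
  obtain ⟨C, hC, δ, hδ, h⟩ := MvPowerSeries.exists_abs_le_mul_sum_of_approx hρ4
    (fun j => (hFρ j).mono hρ4.le (by linarith)) hmul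
    (MvPowerSeries.exists_mem_span_X_mul_det_pderiv_sub_mem F i)
  refine ⟨C, hC, δ, hδ, fun x hx => ?_⟩
  have hprod : ∏ k, x k ^ (Finsupp.single i 1) k = x i := by
    rw [Finset.prod_eq_single i] <;> simp +contextual [eq_comm]
  have := h x hx
  rwa [Pi.mul_apply, hprod, one_mul, abs_mul] at this

theorem norm_mul_jacobian_le_of_analytic (n : ℕ)
    (f : EuclideanSpace ℝ (Fin n) → EuclideanSpace ℝ (Fin n))
    (U : Set (EuclideanSpace ℝ (Fin n))) (hU : U ∈ nhds 0)
    (hf : AnalyticOnNhd ℝ f U) (hf0 : f 0 = 0) :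
    ∃ C > (0 : ℝ), ∃ δ > (0 : ℝ), ∀ x : EuclideanSpace ℝ (Fin n),
      ‖x‖ ≤ δ →
        ‖x‖ * |(Matrix.det fun j i : Fin n =>
            fderiv ℝ f x (EuclideanSpace.single i 1) j)| ≤ C * ‖f x‖ := by
  have hg : ∀ j, AnalyticAt ℝ (fun y : Fin n → ℝ => f (WithLp.toLp 2 y) j) 0 := by
    intro j
    have h0 : AnalyticAt ℝ f ((EuclideanSpace.equiv (Fin n) ℝ).symm 0) := by
      rw [map_zero]
      exact hf 0 (mem_of_mem_nhds hU)
    exact ((EuclideanSpace.proj (𝕜 := ℝ) j).analyticAt _).comp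
      (h0.comp ((EuclideanSpace.equiv (Fin n) ℝ).symm.analyticAt 0))
  choose C hC δ hδ h using fun i => exists_abs_coord_mul_det_lineDeriv_le hg i
  obtain ⟨r, hr, hrδ⟩ : ∃ r > 0, ∀ i, r ≤ δ i := Finite.exists_pos_forall_le hδ
  obtain ⟨s, hs, hsU⟩ := Metric.nhds_basis_closedBall.mem_iff.1 hU
  have hCn : 0 ≤ ∑ i, C i := Finset.sum_nonneg fun i _ => hC i
  refine ⟨(∑ i, C i) * n + 1, by positivity, min r s, lt_min hr hs, fun x hx => ?_⟩
  have hxU : x ∈ U := hsU (by simpa using hx.trans (min_le_right _ _))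
  have hcoord : ∀ y : EuclideanSpace ℝ (Fin n), ∀ i, |y i| ≤ ‖y‖ := fun y i => by
    simpa using PiLp.norm_apply_le y i
  have hx' : ∀ i k, |x k| ≤ δ i := fun i k =>
    (hcoord x k).trans (hx.trans ((min_le_left _ _).trans (hrδ i)))
  set J := Matrix.det fun j i : Fin n => fderiv ℝ f x (EuclideanSpace.single i 1) j
  have hJ : ∀ i, |x i| * |J| ≤ C i * ∑ j, |f x j| := by
    intro i
    have := h i x.ofLp (hx' i)
    simp only [lineDeriv_coord_comp_toLp (hf x hxU).differentiableAt] at this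
    exact this
  have hsum : ∑ j, |f x j| ≤ n * ‖f x‖ := by
    simpa using Finset.sum_le_sum fun j (_ : j ∈ Finset.univ) => hcoord (f x) j
  calc ‖x‖ * |J| ≤ (∑ i, |x i|) * |J| :=
        mul_le_mul_of_nonneg_right (EuclideanSpace.norm_le_sum_abs x) (abs_nonneg _)
    _ ≤ (∑ i, C i) * ∑ j, |f x j| := by
        rw [Finset.sum_mul, Finset.sum_mul]
        exact Finset.sum_le_sum fun i _ => hJ i
    _ ≤ (∑ i, C i) * (n * ‖f x‖) := mul_le_mul_of_nonneg_left hsum hCn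
    _ ≤ ((∑ i, C i) * n + 1) * ‖f x‖ := by
        rw [add_mul, one_mul, mul_assoc]
        exact le_add_of_nonneg_right (norm_nonneg _)
end

section
/- Let r be a positive integer, let n ≥ p ≥ 1, and let f : ℝⁿ → ℝᵖ be a C^r map on a neighbourhood of 0 with f(0)=0. Then the following are equivalent: (1) there exist C, α > 0 such that K_2(f,x) ≥ C‖x‖^{2r} for all ‖x‖ < α; (2) there exist K, β > 0 such that T_2(f,x) ≥ K‖x‖^{2r} for all ‖x‖ < β. -/
open scoped Classical in
/-- The Kuo quantity `K_m(f,x)`. -/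
noncomputable def KuoQ (n p m : ℕ)
    (f : EuclideanSpace ℝ (Fin n) → EuclideanSpace ℝ (Fin p))
    (x : EuclideanSpace ℝ (Fin n)) : ℝ :=
  ‖x‖ ^ m *
      ∑ ι : Fin p → Fin n,
        (if StrictMono ι then
          |(Matrix.det fun j k : Fin p =>
              fderiv ℝ f x (EuclideanSpace.single (ι k) 1) j)| ^ m
        else 0)
    + ‖f x‖ ^ m

open scoped Classical in
/-- The Thom quantity `T_m(f,x)`. -/
noncomputable def ThomQ (n p m : ℕ)
    (f : EuclideanSpace ℝ (Fin n) → EuclideanSpace ℝ (Fin p))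
    (x : EuclideanSpace ℝ (Fin n)) : ℝ :=
  (∑ ι : Fin (p + 1) → Fin n,
      if StrictMono ι then
        |(Matrix.det fun j k : Fin (p + 1) =>
            if h : (j : ℕ) < p then fderiv ℝ f x (EuclideanSpace.single (ι k) 1) ⟨j, h⟩
            else 2 * x (ι k))| ^ m
      else 0)
    + ‖f x‖ ^ m

open scoped IntermediateField.algebraAdjoinAdjoin in
/-- In characteristic zero, a transcendental element admits a derivation taking value `1` on it. -/
theorem exists_derivation_eq_one_of_transcendental {F K : Type*} [Field F] [Field K] [CharZero F]
    [Algebra F K] {y : K} (hy : Transcendental F y) : ∃ d : Derivation F K K, d y = 1 := by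
  classical
  obtain ⟨B, hyB, hB⟩ := exists_isTranscendenceBasis_superset
    (R := F) (s := {y}) (by simpa using hy)
  have hyB' : y ∈ B := hyB rfl
  have hv := hB.1
  have : CharZero (IntermediateField.adjoin F (Set.range ((↑) : B → K))) :=
    charZero_of_injective_algebraMap (algebraMap F _).injective
  have : Algebra.IsAlgebraic (IntermediateField.adjoin F (Set.range ((↑) : B → K))) K :=
    hB.isAlgebraic_field
  have e1 : Algebra.FormallyEtale (Algebra.adjoin F (Set.range ((↑) : B → K)))
      (IntermediateField.adjoin F (Set.range ((↑) : B → K))) :=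
    .of_isLocalization (nonZeroDivisors _)
  have e2 : Algebra.FormallyEtale (IntermediateField.adjoin F (Set.range ((↑) : B → K))) K :=
    Algebra.FormallyEtale.of_isSeparable _ K
  have e3 : Algebra.FormallyEtale (Algebra.adjoin F (Set.range ((↑) : B → K))) K :=
    .comp _ (IntermediateField.adjoin F (Set.range ((↑) : B → K))) _
  let S := Algebra.adjoin F (Set.range ((↑) : B → K))
  let e : MvPolynomial B F ≃ₐ[F] S := hv.aevalEquiv
  let i : B := ⟨y, hyB'⟩
  let D : Derivation F S K := Derivation.mk'
    ((S.val.toLinearMap.comp e.toLinearMap).comp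
      ((MvPolynomial.pderiv i).toLinearMap.comp e.symm.toLinearMap)) (by
      intro a b
      simp [Algebra.smul_def, Derivation.leibniz])
  let T := KaehlerDifferential.tensorKaehlerEquivOfFormallyEtale F S K
  let L : KaehlerDifferential F K →ₗ[K] K :=
    (LinearMap.liftBaseChange K D.liftKaehlerDifferential) ∘ₗ T.symm.toLinearMap
  refine ⟨L.compDer (KaehlerDifferential.D F K), ?_⟩
  have h1 : y = algebraMap S K (e (MvPolynomial.X i)) := by
    have := hv.algebraMap_aevalEquiv (MvPolynomial.X i)
    rw [MvPolynomial.aeval_X] at this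
    exact this.symm
  have h2 := KaehlerDifferential.tensorKaehlerEquivOfFormallyEtale_symm_D_algebraMap F S K
    (e (MvPolynomial.X i))
  change LinearMap.liftBaseChange K D.liftKaehlerDifferential
    (T.symm (KaehlerDifferential.D F K y)) = 1
  rw [h1, h2]
  simp [D]

section ValuedDerivations

open Polynomial

variable {k K Γ : Type*} [Field k] [Field K] [Algebra k K] [LinearOrderedCommGroupWithZero Γ]

/-- If `a` is at least as close to `b` as every root of `Q`, then every term of the Taylor
expansion of `Q` at `a` is dominated at `b` by the value of `Q`. -/
theorem Valuation.map_coeff_taylor_mul_le [IsAlgClosed K] (v : Valuation K Γ) (Q : K[X]) (a b : K)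
    (h : ∀ z, Q.IsRoot z → v (b - a) ≤ v (b - z)) (j : ℕ) :
    v ((taylor a Q).coeff j) * v (b - a) ^ j ≤ v (Q.eval b) := by
  induction hd : Q.natDegree generalizing Q j with
  | zero =>
    rw [eq_C_of_natDegree_eq_zero hd]
    rcases j with _ | j <;> simp [coeff_C]
  | succ d ih =>
    have hQ : Q.degree ≠ 0 := fun h0 => by
      rw [natDegree_eq_zero_iff_degree_le_zero.2 h0.le] at hd; omega
    obtain ⟨z, hz⟩ := IsAlgClosed.exists_root Q hQ
    obtain ⟨Q₁, rfl⟩ := dvd_iff_isRoot.2 hz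
    have hQ₁ : Q₁ ≠ 0 := by rintro rfl; simp at hd
    have hd₁ : Q₁.natDegree = d := by
      rw [natDegree_mul (X_sub_C_ne_zero z) hQ₁, natDegree_X_sub_C] at hd; omega
    have ih' := fun j => ih Q₁ (fun w hw => h w (by
      simp only [IsRoot.def, eval_mul] at hw ⊢; rw [hw, mul_zero])) j hd₁
    have hz' := h z hz
    have haz : v (a - z) ≤ v (b - z) := by
      have : a - z = (b - z) - (b - a) := by ring
      rw [this]
      exact (v.map_sub _ _).trans (max_le le_rfl hz')
    have hT : taylor a ((X - C z) * Q₁) = X * taylor a Q₁ + C (a - z) * taylor a Q₁ := by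
      rw [taylor_mul, _root_.map_sub, taylor_X, taylor_C, C_sub]; ring
    have hconst : v (((C (a - z) * taylor a Q₁).coeff j)) * v (b - a) ^ j
        ≤ v (((X - C z) * Q₁).eval b) := by
      rw [coeff_C_mul, map_mul, eval_mul, map_mul, mul_assoc]
      simpa using mul_le_mul' haz (ih' j)
    rw [hT, coeff_add]
    rcases j with _ | j
    · simpa [taylor_coeff_zero] using hconst
    · have hX : v ((X * taylor a Q₁).coeff (j + 1)) * v (b - a) ^ (j + 1)
          ≤ v (((X - C z) * Q₁).eval b) := by
        rw [coeff_X_mul, eval_mul, map_mul, pow_succ, ← mul_assoc, mul_comm]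
        simpa using mul_le_mul' hz' (ih' j)
      calc _ ≤ max (v ((X * taylor a Q₁).coeff (j + 1)))
            (v ((C (a - z) * taylor a Q₁).coeff (j + 1)))
              * v (b - a) ^ (j + 1) := by gcongr; exact v.map_add _ _
        _ ≤ _ := by
          rcases max_choice (v ((X * taylor a Q₁).coeff (j + 1)))
            (v ((C (a - z) * taylor a Q₁).coeff (j + 1))) with h | h <;> rw [h] <;> assumption

theorem Derivation.apply_eval_sub_eq_sum (d : Derivation k K K) (T : K[X]) (u : K) :
    d (T.eval u) - T.derivative.eval u * d u
      = ∑ j ∈ Finset.range (T.natDegree + 1), d (T.coeff j) * u ^ j := by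
  rw [derivative_eval, sum_over_range _ (by simp), eval_eq_sum_range, map_sum, Finset.sum_mul,
    ← Finset.sum_sub_distrib]
  refine Finset.sum_congr rfl fun j _ => ?_
  rw [Derivation.leibniz, Derivation.leibniz_pow]
  simp only [smul_eq_mul, nsmul_eq_mul]
  ring

theorem Valuation.map_derivation_eval_sub_le (v : Valuation K Γ) (d : Derivation k K K) (T : K[X])
    (u : K) {g : Γ} (h : ∀ j, v (d (T.coeff j)) * v u ^ j ≤ g) :
    v (d (T.eval u) - T.derivative.eval u * d u) ≤ g := by
  rw [d.apply_eval_sub_eq_sum]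
  exact v.map_sum_le fun j _ => by simpa using h j

theorem natDegree_minpoly_aeval_le {F : Type*} [Field F] [Algebra F K] {r : K}
    (hr : IsIntegral F r) (q : F[X]) :
    (minpoly F (aeval r q)).natDegree ≤ (minpoly F r).natDegree := by
  have : FiniteDimensional F (IntermediateField.adjoin F {r}) :=
    IntermediateField.adjoin.finiteDimensional hr
  have h := minpoly.natDegree_le (A := F) (aeval (IntermediateField.AdjoinSimple.gen F r) q)
  rw [IntermediateField.adjoin.finrank hr] at h
  convert h using 2
  have := minpoly.algebraMap_eq (A := F) (B := IntermediateField.adjoin F {r}) (B' := K)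
    (algebraMap (IntermediateField.adjoin F {r}) K).injective
      (aeval (IntermediateField.AdjoinSimple.gen F r) q)
  rw [← this, ← aeval_algebraMap_apply, IntermediateField.AdjoinSimple.algebraMap_gen]

theorem isIntegral_aeval {F : Type*} [Field F] [Algebra F K] {r : K} (hr : IsIntegral F r)
    (q : F[X]) : IsIntegral F (aeval r q) :=
  by
  have h := (aeval (⟨r, hr⟩ : integralClosure F K) q).2
  rwa [← Subalgebra.coe_val, ← aeval_algHom_apply] at h

theorem coeff_taylor_map {F : Type*} [Field F] [Algebra F K] (r : K) (P : F[X]) (j : ℕ) :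
    (taylor r (P.map (algebraMap F K))).coeff j = aeval r (hasseDeriv j P) := by
  rw [taylor_coeff, aeval_def, eval₂_eq_eval_map]
  congr 1
  ext i
  simp [hasseDeriv_coeff]

/-- Let `d` be a derivation of an algebraically closed valued field of residue characteristic zero.
Whether `d` is monotone (`v (d b) ≤ v b`) at an element `b` algebraic over a subfield `F` is
controlled by finitely many elements of `F`, independently of `d`. -/
theorem exists_finset_forall_derivation_le (k : Type*) [Field k] [Algebra k K]
    [IsAlgClosed K] (v : Valuation K Γ)
    (hv : ∀ m : ℕ, m ≠ 0 → v (m : K) = 1) {F : Type*} [Field F] [Algebra F K] (b : K)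
    (hb : IsIntegral F b) :
    ∃ S : Finset F, ∀ d : Derivation k K K,
      (∀ c ∈ S, v (d (algebraMap F K c)) ≤ v (algebraMap F K c)) → v (d b) ≤ v b := by
  classical
  have : CharZero K := charZero_of_inj_zero fun m hm => by
    by_contra h
    have := hv m h
    simp [hm] at this
  have : CharZero F := (algebraMap F K).charZero_iff (algebraMap F K).injective |>.2 this
  induction hn : (minpoly F b).natDegree using Nat.strong_induction_on generalizing b with
  | _ n ih =>
  have hn0 : 0 < n := hn ▸ minpoly.natDegree_pos hb
  rcases Nat.lt_or_ge 1 n with hn1 | hn1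
  swap
  · obtain ⟨c, rfl⟩ := (minpoly.natDegree_eq_one_iff (A := F) (x := b)).1 (by omega)
    exact ⟨{c}, fun d hd => hd c (by simp)⟩
  set P := (minpoly F b).map (algebraMap F K) with hP
  have hPb : P.eval b = 0 := by
    rw [hP, eval_map_algebraMap, minpoly.aeval]
  have hPb' : P.derivative.eval b ≠ 0 := by
    rw [hP, derivative_map, eval_map_algebraMap]
    exact (minpoly.irreducible hb).separable.aeval_derivative_ne_zero (minpoly.aeval F b)
  have hP'0 : P.derivative ≠ 0 := by rintro h; simp [h] at hPb'
  set Z : Finset K := insert 0 P.derivative.roots.toFinset with hZ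
  obtain ⟨r, hrZ, hrmin⟩ := Z.exists_min_image (fun z => v (b - z)) ⟨0, by simp [hZ]⟩
  have hr : IsIntegral F r ∧ (minpoly F r).natDegree < n := by
    rcases Finset.mem_insert.1 hrZ with rfl | hr
    · exact ⟨isIntegral_zero, by simpa [minpoly.zero] using hn1⟩
    · have hr0 : aeval r (minpoly F b).derivative = 0 := by
        have := isRoot_of_mem_roots (Multiset.mem_toFinset.1 hr)
        rwa [IsRoot.def, hP, derivative_map, eval_map_algebraMap] at this
      have hne : (minpoly F b).derivative ≠ 0 := by
        intro h
        rw [hP, derivative_map, h] at hP'0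
        simp at hP'0
      refine ⟨(isAlgebraic_iff_isIntegral).1 ⟨_, hne, hr0⟩, ?_⟩
      calc _ ≤ (minpoly F b).derivative.natDegree := natDegree_le_of_dvd (minpoly.dvd F r hr0) hne
        _ < _ := hn ▸ natDegree_derivative_lt (by omega)
  obtain ⟨Sr, hSr⟩ := ih _ hr.2 r hr.1 rfl
  have hcoef := fun j : ℕ => ih _ ((natDegree_minpoly_aeval_le hr.1
    (hasseDeriv j (minpoly F b))).trans_lt hr.2) _
    (isIntegral_aeval hr.1 _) rfl
  choose Sc hSc using hcoef
  refine ⟨Sr ∪ (Finset.range (n + 1)).biUnion Sc, fun d hd => ?_⟩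
  have hdr := hSr d fun c hc => hd c (Finset.mem_union_left _ hc)
  set T := taylor r P with hT
  have hdeg : T.natDegree ≤ n := by
    rw [hT, natDegree_taylor, hP]; exact (natDegree_map_le).trans hn.le
  have hdT : ∀ j, v (d (T.coeff j)) ≤ v (T.coeff j) := by
    intro j
    rcases Nat.lt_or_ge n j with hj | hj
    · rw [coeff_eq_zero_of_natDegree_lt (hdeg.trans_lt hj)]; simp
    · rw [hT, hP, coeff_taylor_map]
      exact hSc j d fun c hc => hd c (Finset.mem_union_right _
        (Finset.mem_biUnion.2 ⟨j, by simp; omega, hc⟩))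
  have hbr : v (b - r) ≤ v b := by simpa using hrmin 0 (by simp [hZ])
  have hTu : T.eval (b - r) = 0 := by rw [hT, taylor_eval]; simpa using hPb
  have hT' : derivative T = taylor r (derivative P) := by
    rw [hT, taylor_apply, taylor_apply, derivative_comp]; simp
  have hT'u : (derivative T).eval (b - r) = P.derivative.eval b := by
    rw [hT', taylor_eval]; simp
  have hsucc : ∀ j, v (T.coeff (j + 1)) * v (b - r) ^ (j + 1)
      ≤ v (P.derivative.eval b) * v (b - r) := by
    intro j
    have h1 := v.map_coeff_taylor_mul_le P.derivative r b (fun z hz => hrmin z (by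
      rw [hZ, Finset.mem_insert, Multiset.mem_toFinset, mem_roots hP'0]; exact Or.inr hz)) j
    rw [← hT', coeff_derivative, map_mul, show (j : K) + 1 = ((j + 1 : ℕ) : K) by push_cast; rfl,
      hv _ (by omega), mul_one] at h1
    rw [pow_succ, ← mul_assoc]
    gcongr
  have hall : ∀ j, v (T.coeff j) * v (b - r) ^ j ≤ v (P.derivative.eval b) * v (b - r) := by
    rintro (_ | j)
    · have h0 := hTu
      rw [eval_eq_sum_range, Finset.sum_range_succ'] at h0
      rw [pow_zero, mul_one, show T.coeff 0 = -∑ j ∈ Finset.range T.natDegree,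
        T.coeff (j + 1) * (b - r) ^ (j + 1) by linear_combination h0, Valuation.map_neg]
      exact v.map_sum_le fun j _ => by simpa using hsucc j
    · exact hsucc j
  have key := v.map_derivation_eval_sub_le d T (b - r) (fun j =>
    (mul_le_mul_left (hdT j) (v (b - r) ^ j)).trans (hall j))
  rw [hTu, map_zero, zero_sub, Valuation.map_neg, hT'u, map_mul] at key
  have hu : v (d (b - r)) ≤ v (b - r) :=
    le_of_mul_le_mul_left key (zero_lt_iff.2 ((Valuation.ne_zero_iff _).2 hPb'))
  have hrb : v r ≤ v b := by
    have : r = b - (b - r) := by ring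
    rw [this]
    exact (v.map_sub _ _).trans (max_le le_rfl hbr)
  have : d b = d (b - r) + d r := by rw [map_sub]; ring
  rw [this]
  exact (v.map_add _ _).trans (max_le (hu.trans hbr) (hdr.trans hrb))

theorem Derivation.apply_eq_zero_of_isAlgebraic {F : Type*} [Field F] [CharZero F] [Algebra F K]
    (d : Derivation F K K) {c : K} (hc : IsAlgebraic F c) : d c = 0 := by
  have h := d.map_aeval (minpoly F c) c
  rw [minpoly.aeval, map_zero, smul_eq_mul, eq_comm, mul_eq_zero] at h
  exact h.resolve_left ((minpoly.irreducible hc.isIntegral).separable.aeval_derivative_ne_zero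
    (minpoly.aeval F c))

theorem Valuation.map_derivation_div_le (v : Valuation K Γ) (d : Derivation k K K) {a b : K}
    (ha : v (d a) ≤ v a) (hb : v (d b) ≤ v b) : v (d (a / b)) ≤ v (a / b) := by
  rcases eq_or_ne b 0 with rfl | hb0
  · simp
  rw [Derivation.leibniz_div]
  simp only [smul_eq_mul, map_mul, map_pow, map_inv₀, map_div₀]
  have hvb : v b ≠ 0 := (Valuation.ne_zero_iff _).2 hb0
  calc (v b)⁻¹ ^ 2 * v (b * d a - a * d b) ≤ (v b)⁻¹ ^ 2 * (v b * v a) := by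
        gcongr
        refine (v.map_sub _ _).trans (max_le ?_ ?_)
        · rw [map_mul]; gcongr
        · rw [map_mul, mul_comm]; gcongr
    _ = v a / v b := by field_simp

/-- For every finite set of elements of `K` algebraic over `F` there is a `k`-derivation of `K`
which multiplies `s` by `1` and does not increase the valuation on the given finite set. -/
def HasMonotoneDerivations (k : Type*) [Field k] [Algebra k K] (v : Valuation K Γ) (s : K)
    (F : Type*) [Field F] [Algebra F K] : Prop :=
  ∀ S : Finset K, (∀ a ∈ S, IsAlgebraic F a) →
    ∃ δ : Derivation k K K, δ s = s ∧ ∀ a ∈ S, v (δ a) ≤ v a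

open IntermediateField in
theorem hasMonotoneDerivations_adjoin_simple [IsAlgClosed K] {v : Valuation K Γ}
    (hv : ∀ m : ℕ, m ≠ 0 → v (m : K) = 1) {s : K} {F : Type*} [Field F] [Algebra F K] {y : K}
    (h : ∀ G : Finset F[X], ∃ δ : Derivation k K K, δ s = s ∧
      ∀ g ∈ G, v (δ (aeval y g)) ≤ v (aeval y g)) :
    HasMonotoneDerivations k v s F⟮y⟯ := by
  classical
  intro S hS
  have hfin : ∀ a : K, ∃ T : Finset F⟮y⟯, a ∈ S → ∀ d : Derivation k K K,
      (∀ c ∈ T, v (d (algebraMap F⟮y⟯ K c)) ≤ v (algebraMap F⟮y⟯ K c)) → v (d a) ≤ v a := by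
    intro a
    by_cases ha : a ∈ S
    · obtain ⟨T, hT⟩ := exists_finset_forall_derivation_le k v hv (F := F⟮y⟯) a (hS a ha).isIntegral
      exact ⟨T, fun _ => hT⟩
    · exact ⟨∅, fun h => absurd h ha⟩
  choose T hT using hfin
  have hrep : ∀ c : F⟮y⟯, ∃ p q : F[X], (c : K) = aeval y p / aeval y q :=
    fun c => (mem_adjoin_simple_iff F _).1 c.2
  choose p q hpq using hrep
  obtain ⟨δ, hδs, hδ⟩ := h ((S.biUnion T).image p ∪ (S.biUnion T).image q)
  refine ⟨δ, hδs, fun a ha => hT a ha δ fun c hc => ?_⟩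
  have hc' : c ∈ S.biUnion T := Finset.mem_biUnion.2 ⟨a, ha, hc⟩
  rw [IntermediateField.algebraMap_apply, hpq]
  exact v.map_derivation_div_le δ
    (hδ _ (Finset.mem_union_left _ (Finset.mem_image_of_mem _ hc')))
    (hδ _ (Finset.mem_union_right _ (Finset.mem_image_of_mem _ hc')))

theorem Valuation.map_aeval_le_one {v : Valuation K Γ}
    (hv : ∀ c : k, c ≠ 0 → v (algebraMap k K c) = 1) {s : K} (hs : v s ≤ 1) (q : k[X]) :
    v (aeval s q) ≤ 1 := by
  rw [aeval_eq_sum_range]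
  refine v.map_sum_le fun j _ => ?_
  rw [Algebra.smul_def, map_mul, map_pow]
  refine mul_le_one' ?_ (pow_le_one' hs j)
  by_cases hc : q.coeff j = 0
  · simp [hc]
  · exact (hv _ hc).le

theorem Valuation.map_aeval_eq_one {v : Valuation K Γ}
    (hv : ∀ c : k, c ≠ 0 → v (algebraMap k K c) = 1) {s : K} (hs : v s < 1) {g : k[X]}
    (hg : g.coeff 0 ≠ 0) : v (aeval s g) = 1 := by
  rw [← g.divX_mul_X_add, map_add, map_mul, aeval_X, aeval_C]
  rw [← hv _ hg]
  refine v.map_add_eq_of_lt_right ?_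
  rw [hv _ hg, map_mul]
  exact (mul_le_mul' (v.map_aeval_le_one hv hs.le _) le_rfl).trans_lt (by simpa using hs)

open IntermediateField in
theorem hasMonotoneDerivations_adjoin_self [IsAlgClosed K] [CharZero k] {v : Valuation K Γ}
    (hv : ∀ c : k, c ≠ 0 → v (algebraMap k K c) = 1) {s : K} (hs0 : s ≠ 0) (hs : v s < 1) :
    HasMonotoneDerivations k v s k⟮s⟯ := by
  have hfac : ∀ g : k[X], g ≠ 0 → ∃ (j : ℕ) (g₀ : k[X]), g = X ^ j * g₀ ∧ g₀.coeff 0 ≠ 0 := by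
    intro g hg
    obtain ⟨g₀, h1, h2⟩ := exists_eq_pow_rootMultiplicity_mul_and_not_dvd g hg 0
    exact ⟨_, g₀, by simpa using h1, fun h => h2 (by simpa [X_dvd_iff] using h)⟩
  have htr : Transcendental k s := by
    rw [transcendental_iff]
    intro g hg
    by_contra hg0
    obtain ⟨j, g₀, rfl, h0⟩ := hfac g hg0
    have := v.map_aeval_eq_one hv hs h0
    rw [map_mul, map_pow, aeval_X, mul_eq_zero] at hg
    rcases hg with h | h
    · exact pow_ne_zero j hs0 h
    · simp [h] at this
  obtain ⟨d, hd⟩ := exists_derivation_eq_one_of_transcendental htr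
  refine hasMonotoneDerivations_adjoin_simple (fun m hm => ?_) fun G => ⟨s • d, by simp [hd], ?_⟩
  · simpa using hv m (by exact_mod_cast hm)
  intro g _
  rcases eq_or_ne g 0 with rfl | hg0
  · simp
  obtain ⟨j, g₀, rfl, h0⟩ := hfac g hg0
  have hder : s * aeval s (derivative (X ^ j * g₀))
      = s ^ j * aeval s (C (j : k) * g₀ + X * derivative g₀) := by
    rcases j with _ | j
    · simp
    · simp; ring
  rw [Derivation.smul_apply, d.map_aeval, hd, smul_eq_mul, smul_eq_mul, mul_one, hder]
  simp only [map_mul, map_pow, aeval_X, v.map_aeval_eq_one hv hs h0]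
  gcongr
  exact v.map_aeval_le_one hv hs.le _

theorem Derivation.exists_monotone_of_transcendental [IsAlgClosed K] {v : Valuation K Γ} {s : K}
    {F : IntermediateField k K} [CharZero k] (hF : HasMonotoneDerivations k v s F) (hs : s ∈ F)
    {y : K}
    (hy : Transcendental F y) (G : Finset F[X]) :
    ∃ δ : Derivation k K K, δ s = s ∧ ∀ g ∈ G, v (δ (aeval y g)) ≤ v (aeval y g) := by
  classical
  have : CharZero F := charZero_of_injective_algebraMap (algebraMap k F).injective
  set Z : Finset K := insert 0 (G.biUnion fun g => (g.map (algebraMap F K)).roots.toFinset) with hZ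
  obtain ⟨a, haZ, hamin⟩ := Z.exists_min_image (fun z => v (y - z)) ⟨0, by simp [hZ]⟩
  have ha : IsAlgebraic F a := by
    rcases Finset.mem_insert.1 haZ with rfl | h
    · exact isAlgebraic_zero
    · obtain ⟨g, hg, hga⟩ := Finset.mem_biUnion.1 h
      have hga := Multiset.mem_toFinset.1 hga
      have := isRoot_of_mem_roots hga
      refine ⟨g, ?_, by rwa [IsRoot.def, eval_map_algebraMap] at this⟩
      rintro rfl
      simp at hga
  let c : F[X] → ℕ → K := fun g j => (taylor a (g.map (algebraMap F K))).coeff j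
  have hc : ∀ g j, IsAlgebraic F (c g j) := fun g j => by
    simp only [c, coeff_taylor_map]
    exact (isIntegral_aeval ha.isIntegral _).isAlgebraic
  obtain ⟨δ₀, hδ₀s, hδ₀⟩ := hF (G.biUnion fun g => (Finset.range (g.natDegree + 1)).image (c g)) (by
    intro b hb
    simp only [Finset.mem_biUnion, Finset.mem_image] at hb
    obtain ⟨g, _, j, _, rfl⟩ := hb
    exact hc g j)
  obtain ⟨e, he⟩ := exists_derivation_eq_one_of_transcendental hy
  let e' : Derivation k K K := e.restrictScalars k
  have he' : ∀ b, e' b = e b := fun _ => rfl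
  let δ : Derivation k K K := δ₀ + (δ₀ a - δ₀ y) • e'
  have hδ : ∀ b, IsAlgebraic F b → δ b = δ₀ b := fun b hb => by
    simp [δ, he', e.apply_eq_zero_of_isAlgebraic hb]
  have hδy : δ (y - a) = 0 := by
    rw [map_sub, hδ a ha]
    simp [δ, he', he]
  refine ⟨δ, ?_, fun g hg => ?_⟩
  · rw [hδ s (isAlgebraic_algebraMap (⟨s, hs⟩ : F)), hδ₀s]
  have hT : (taylor a (g.map (algebraMap F K))).eval (y - a) = aeval y g := by
    rw [taylor_eval]; simp
  rcases eq_or_ne g 0 with rfl | hg0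
  · simp
  have key := v.map_derivation_eval_sub_le δ (taylor a (g.map (algebraMap F K))) (y - a)
    (g := v (aeval y g)) (fun j => ?_)
  · rwa [hδy, mul_zero, sub_zero, hT] at key
  have h1 : v (δ (c g j)) ≤ v (c g j) := by
    rcases Nat.lt_or_ge g.natDegree j with hj | hj
    · have : c g j = 0 := coeff_eq_zero_of_natDegree_lt (by
        rw [natDegree_taylor]; exact natDegree_map_le.trans_lt hj)
      simp [this]
    · rw [hδ _ (hc g j)]
      exact hδ₀ _ (Finset.mem_biUnion.2 ⟨g, hg, Finset.mem_image_of_mem _ (by simp; omega)⟩)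
  refine (mul_le_mul_left h1 _).trans ?_
  have := v.map_coeff_taylor_mul_le (g.map (algebraMap F K)) a y (fun z hz => hamin z ?_) j
  · simpa using this
  · refine Finset.mem_insert_of_mem (Finset.mem_biUnion.2 ⟨g, hg, ?_⟩)
    rw [Multiset.mem_toFinset, mem_roots]
    · exact hz
    · rwa [Ne, Polynomial.map_eq_zero]

open IntermediateField in
/-- Over an algebraically closed field `K` with a valuation trivial on the subfield `k`, there are
`k`-derivations with `δ s = s` not increasing the valuation on any prescribed finite set. -/
theorem exists_derivation_forall_map_le [IsAlgClosed K] [CharZero k] {v : Valuation K Γ}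
    (hv : ∀ c : k, c ≠ 0 → v (algebraMap k K c) = 1) {s : K} (hs0 : s ≠ 0) (hs : v s < 1)
    (S : Finset K) : ∃ δ : Derivation k K K, δ s = s ∧ ∀ a ∈ S, v (δ a) ≤ v a := by
  classical
  have hv' : ∀ m : ℕ, m ≠ 0 → v (m : K) = 1 := fun m hm => by
    simpa using hv m (by exact_mod_cast hm)
  suffices ∃ F : IntermediateField k K, HasMonotoneDerivations k v s F ∧ s ∈ F ∧ ∀ a ∈ S, a ∈ F by
    obtain ⟨F, hF, -, hS⟩ := this
    exact hF S fun a ha => isAlgebraic_algebraMap (⟨a, hS a ha⟩ : F)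
  induction S using Finset.induction_on with
  | empty => exact ⟨k⟮s⟯, hasMonotoneDerivations_adjoin_self hv hs0 hs,
      mem_adjoin_simple_self k s, by simp⟩
  | insert y S _ ih =>
    obtain ⟨F, hF, hsF, hSF⟩ := ih
    have hle : ∀ a ∈ F, a ∈ F⟮y⟯.restrictScalars k := fun a ha =>
      F⟮y⟯.algebraMap_mem ⟨a, ha⟩
    refine ⟨F⟮y⟯.restrictScalars k, ?_, hle s hsF, fun a ha => ?_⟩
    · change HasMonotoneDerivations k v s F⟮y⟯
      by_cases hy : Transcendental F y
      · exact hasMonotoneDerivations_adjoin_simple hv'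
          (Derivation.exists_monotone_of_transcendental hF hsF hy)
      · have hy' : IsAlgebraic F y := not_not.1 hy
        have := isAlgebraic_adjoin_simple hy'.isIntegral
        exact fun S hS => hF S fun a ha => (hS a ha).restrictScalars F
    · rcases Finset.mem_insert.1 ha with rfl | ha
      · exact mem_adjoin_simple_self F a
      · exact hle a (hSF a ha)

end ValuedDerivations

section UltrapowerValuation

open Filter Asymptotics Polynomial

variable {ι : Type*} (φ : Ultrafilter ι)

noncomputable instance Filter.Germ.instAlgebraUltrapower :
    Algebra ℝ (Germ (φ : Filter ι) ℂ) :=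
  Algebra.ofModule
    (fun c f g => Germ.inductionOn₂ f g fun f g => congrArg Germ.ofFun (smul_mul_assoc c f g))
    (fun c f g => Germ.inductionOn₂ f g fun f g => congrArg Germ.ofFun (mul_smul_comm c f g))

theorem Filter.Germ.algebraMap_eq_const (c : ℝ) :
    algebraMap ℝ (Germ (φ : Filter ι) ℂ) c =
      ((fun _ => (c : ℂ) : ι → ℂ) : Germ (φ : Filter ι) ℂ) := by
  rw [Algebra.algebraMap_eq_smul_one]
  refine congrArg Germ.ofFun (funext fun i => ?_)
  simp

instance Filter.Germ.instIsAlgClosedUltrapower : IsAlgClosed (Germ (φ : Filter ι) ℂ) := by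
  refine IsAlgClosed.of_exists_root _ fun p hp hirr => ?_
  have hlift : p ∈ lifts (Germ.coeRingHom (φ : Filter ι) : (ι → ℂ) →+* _) :=
    map_surjective _ Quot.mk_surjective p
  obtain ⟨Q, hQp, hQd, hQ⟩ := lifts_and_natDegree_eq_and_monic hlift hp
  have hroot : ∀ i, ∃ z : ℂ, (Q.map (Pi.evalRingHom (fun _ => ℂ) i)).eval z = 0 := fun i =>
    IsAlgClosed.exists_root _ fun h => by
      have h1 : (Q.map (Pi.evalRingHom (fun _ => ℂ) i)).natDegree = 0 :=
        natDegree_eq_zero_iff_degree_le_zero.2 h.le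
      rw [hQ.natDegree_map, hQd] at h1
      exact hirr.natDegree_pos.ne' h1
  choose z hz using hroot
  refine ⟨Germ.coeRingHom (φ : Filter ι) z, ?_⟩
  rw [← hQp, eval_map, eval₂_hom]
  have : Q.eval z = 0 := by
    funext i
    have := hz i
    rw [eval_map] at this
    rw [Pi.zero_apply, ← this]
    exact (eval₂_hom (Pi.evalRingHom (fun _ => ℂ) i) z).symm
  rw [this, map_zero]

/-- The valuation ring of bounded germs along an ultrafilter. -/
noncomputable def boundedGerms : ValuationSubring (Germ (φ : Filter ι) ℂ) where
  carrier := {g | ∃ C : ℝ, g.LiftPred fun z => ‖z‖ ≤ C}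
  mul_mem' := by
    rintro a b ⟨C, hC⟩ ⟨D, hD⟩
    refine ⟨C * D, ?_⟩
    induction a, b using Germ.inductionOn₂ with | _ f g => ?_
    filter_upwards [hC, hD] with i hi hj
    rw [norm_mul]
    exact mul_le_mul hi hj (norm_nonneg _) ((norm_nonneg _).trans hi)
  one_mem' := ⟨1, Eventually.of_forall fun i => by simp⟩
  add_mem' := by
    rintro a b ⟨C, hC⟩ ⟨D, hD⟩
    refine ⟨C + D, ?_⟩
    induction a, b using Germ.inductionOn₂ with | _ f g => ?_
    filter_upwards [hC, hD] with i hi hj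
    exact (norm_add_le _ _).trans (add_le_add hi hj)
  zero_mem' := ⟨0, Eventually.of_forall fun i => by simp⟩
  neg_mem' := by
    rintro a ⟨C, hC⟩
    refine ⟨C, ?_⟩
    induction a using Germ.inductionOn with | _ f => ?_
    filter_upwards [hC] with i hi
    rwa [Function.comp_apply, norm_neg]
  mem_or_inv_mem' := by
    intro a
    induction a using Germ.inductionOn with | _ f => ?_
    rcases φ.em fun i => ‖f i‖ ≤ 1 with h | h
    · exact Or.inl ⟨1, h⟩
    · refine Or.inr ⟨1, ?_⟩
      filter_upwards [h] with i hi
      rw [Function.comp_apply, norm_inv]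
      exact inv_le_one_of_one_le₀ (not_le.1 hi).le

variable {φ}

theorem boundedGerms_valuation_le_iff {f g : ι → ℂ} :
    (boundedGerms φ).valuation f ≤ (boundedGerms φ).valuation g ↔ f =O[φ] g := by
  rw [ValuationSubring.valuation_le_iff]
  constructor
  · rintro ⟨⟨c, C, hc⟩, h⟩
    induction c using Germ.inductionOn with | _ c => ?_
    refine IsBigO.of_bound C ?_
    filter_upwards [hc, Germ.coe_eq.1 h] with i hi hj
    rw [← hj, norm_mul]
    gcongr
  · intro h
    obtain ⟨C, hC⟩ := h.bound
    refine ⟨⟨((f / g : ι → ℂ) : Germ (φ : Filter ι) ℂ), max C 0, ?_⟩, Germ.coe_eq.2 ?_⟩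
    · filter_upwards [hC] with i hi
      rw [Pi.div_apply, norm_div]
      exact div_le_of_le_mul₀ (norm_nonneg _) (le_max_right _ _)
        (hi.trans (by gcongr; exact le_max_left _ _))
    · filter_upwards [hC] with i hi
      rcases eq_or_ne (g i) 0 with h0 | h0
      · simp only [h0, norm_zero, mul_zero, norm_le_zero_iff] at hi
        simp [h0, hi]
      · simp [h0]

theorem isLittleO_of_boundedGerms_valuation_lt {f g : ι → ℂ}
    (h : (boundedGerms φ).valuation f < (boundedGerms φ).valuation g) : f =o[φ] g := by
  rw [← not_le, boundedGerms_valuation_le_iff] at h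
  refine IsLittleO.of_bound fun c hc => ?_
  refine (φ.em fun i => ‖f i‖ ≤ c * ‖g i‖).resolve_right fun hn => h ?_
  refine IsBigO.of_bound c⁻¹ ?_
  filter_upwards [hn] with i hi
  rw [inv_mul_eq_div, le_div_iff₀ hc, mul_comm]
  exact (not_le.1 hi).le

theorem boundedGerms_valuation_lt {f g : ι → ℂ} (hg : ∀ᶠ i in φ, g i ≠ 0) (h : f =o[φ] g) :
    (boundedGerms φ).valuation f < (boundedGerms φ).valuation g := by
  rw [← not_le, boundedGerms_valuation_le_iff]
  intro h'
  exact isLittleO_irrefl hg.frequently (h'.trans_isLittleO h)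

theorem boundedGerms_valuation_algebraMap {c : ℝ} (hc : c ≠ 0) :
    (boundedGerms φ).valuation (algebraMap ℝ _ c) = 1 := by
  rw [Germ.algebraMap_eq_const, ← map_one (boundedGerms φ).valuation]
  have hc' : (c : ℂ) ≠ 0 := by exact_mod_cast hc
  refine le_antisymm ?_ ?_
  · exact boundedGerms_valuation_le_iff (g := 1).2 (isBigO_const_const _ one_ne_zero _)
  · exact boundedGerms_valuation_le_iff (f := 1).2 (isBigO_const_const _ hc' _)

end UltrapowerValuation

section TangentLift

open Filter Asymptotics Topology

variable {ι : Type*} {φ : Ultrafilter ι}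

theorem Derivation.map_mvPolynomial_aeval {R A σ : Type*} [CommRing R] [CommRing A] [Algebra R A]
    [Fintype σ] (d : Derivation R A A) (X : σ → A) (P : MvPolynomial σ R) :
    d (MvPolynomial.aeval X P) = ∑ k, MvPolynomial.aeval X (MvPolynomial.pderiv k P) * d (X k) := by
  classical
  induction P using MvPolynomial.induction_on with
  | C a => simp
  | add p q hp hq => simp [hp, hq, add_mul, Finset.sum_add_distrib]
  | mul_X p j hp =>
    simp only [map_mul, MvPolynomial.aeval_X, Derivation.leibniz, hp, MvPolynomial.pderiv_X,
      smul_eq_mul, map_add, add_mul, Finset.sum_add_distrib]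
    congr 1
    · rw [Finset.sum_eq_single j]
      · simp
      · intro b _ hb
        simp [Pi.single_eq_of_ne' hb]
      · simp
    · rw [Finset.mul_sum]
      exact Finset.sum_congr rfl fun k _ => by ring

theorem Ultrafilter.exists_eventually_of_finite {κ : Type*} [Finite κ] {p : κ → ι → Prop}
    (h : ∀ᶠ i in φ, ∃ k, p k i) : ∃ k, ∀ᶠ i in φ, p k i := by
  by_contra! hn
  have := eventually_all.2 hn
  obtain ⟨i, hi, k, hk⟩ := (this.and h).exists
  exact hi k hk

theorem Ultrafilter.exists_tendsto_of_abs_le_one {g : ι → ℝ} (h : ∀ᶠ i in φ, |g i| ≤ 1) :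
    ∃ u, Tendsto g φ (𝓝 u) := by
  obtain ⟨u, -, hu⟩ := (isCompact_Icc (a := (-1 : ℝ)) (b := 1)).ultrafilter_le_nhds' (φ.map g)
    (h.mono fun i hi => abs_le.1 hi)
  exact ⟨u, hu⟩

theorem Filter.Germ.aeval_coe {σ : Type*} (x : ι → σ → ℝ) (P : MvPolynomial σ ℝ) :
    MvPolynomial.aeval
        (fun k => ((fun i => (x i k : ℂ) : ι → ℂ) : Germ (φ : Filter ι) ℂ)) P
      = ((fun i => (MvPolynomial.eval (x i) P : ℂ) : ι → ℂ) : Germ (φ : Filter ι) ℂ) := by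
  induction P using MvPolynomial.induction_on with
  | C a => simp [Germ.algebraMap_eq_const]
  | add p q hp hq =>
    simp only [map_add, hp, hq, Complex.ofReal_add]
    rfl
  | mul_X p k hp =>
    simp only [map_mul, hp, MvPolynomial.aeval_X, MvPolynomial.eval_X, Complex.ofReal_mul]
    rfl

theorem exists_maximal_coordinate {n : ℕ} {x : ι → EuclideanSpace ℝ (Fin n)}
    (hx0 : ∀ᶠ i in φ, x i ≠ 0) :
    ∃ m, ∀ᶠ i in φ, x i m ≠ 0 ∧ ∀ k, |x i k| ≤ |x i m| := by
  refine Ultrafilter.exists_eventually_of_finite ?_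
  filter_upwards [hx0] with i hi
  obtain ⟨j, hj⟩ : ∃ j, x i j ≠ 0 := by
    by_contra! h
    exact hi (by ext j; simpa using h j)
  obtain ⟨m, -, hm⟩ := Finset.exists_max_image Finset.univ (fun k => |x i k|) ⟨j, Finset.mem_univ j⟩
  exact ⟨m, abs_pos.1 ((abs_pos.2 hj).trans_le (hm j (Finset.mem_univ j))),
    fun k => hm k (Finset.mem_univ k)⟩

theorem isLittleO_euclideanSpace {l : Filter ι} {n : ℕ} {z : ι → EuclideanSpace ℝ (Fin n)}
    {G : Type*} [NormedAddCommGroup G] {g : ι → G} (h : ∀ k, (fun i => z i k) =o[l] g) :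
    z =o[l] g := by
  have hz : z = fun i => ∑ k, z i k • EuclideanSpace.basisFun (Fin n) ℝ k := by
    funext i
    simpa using ((EuclideanSpace.basisFun (Fin n) ℝ).sum_repr (z i)).symm
  rw [hz]
  refine IsLittleO.fun_sum fun k _ => ?_
  have hk : (fun i => z i k • EuclideanSpace.basisFun (Fin n) ℝ k) =O[l] fun i => z i k :=
    IsBigO.of_bound 1 (Eventually.of_forall fun i => by simp [norm_smul])
  exact hk.trans_isLittleO (h k)

/-- Along any sequence `x` tending to `0`, and for finitely many polynomials `P j`, there is a
sequence `w` asymptotic to `x` along which the derivative of each `P j` is controlled by `P j`. -/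
theorem exists_isLittleO_sub_forall_isBigO_pderiv {n : ℕ} {κ : Type*} [Fintype κ]
    (P : κ → MvPolynomial (Fin n) ℝ) {x : ι → EuclideanSpace ℝ (Fin n)}
    (hx : Tendsto x φ (𝓝 0)) (hx0 : ∀ᶠ i in φ, x i ≠ 0) :
    ∃ w : ι → EuclideanSpace ℝ (Fin n), (fun i => w i - x i) =o[φ] x ∧
      ∀ j, (fun i => ∑ k, MvPolynomial.eval (x i) (MvPolynomial.pderiv k (P j)) * w i k)
        =O[φ] fun i => MvPolynomial.eval (x i) (P j) := by
  classical
  obtain ⟨m, hm⟩ := exists_maximal_coordinate hx0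
  have hu : ∀ k, ∃ u, Tendsto (fun i => x i k / x i m) φ (𝓝 u) := fun k =>
    Ultrafilter.exists_tendsto_of_abs_le_one (by
      filter_upwards [hm] with i hi
      rw [abs_div]
      exact div_le_one_of_le₀ (hi.2 k) (abs_nonneg _))
  choose u hu using hu
  let K := Germ (φ : Filter ι) ℂ
  let v := (boundedGerms φ).valuation
  let X : Fin n → K := fun k => ((fun i => (x i k : ℂ) : ι → ℂ) : K)
  let E : Fin n → K := fun k => X k - algebraMap ℝ K (u k) * X m
  have hXm : ∀ᶠ i in φ, (x i m : ℂ) ≠ 0 := hm.mono fun i hi => by exact_mod_cast hi.1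
  have hs0 : X m ≠ 0 := fun h => by
    obtain ⟨i, hi, hi'⟩ := ((Germ.coe_eq.1 h).and hXm).exists
    exact hi' hi
  have hs : v (X m) < 1 := by
    have : Tendsto (fun i => (x i m : ℂ)) φ (𝓝 0) := by
      have h1 : Tendsto (fun i => x i m) φ (𝓝 0) := by
        have := ((EuclideanSpace.proj m :
          EuclideanSpace ℝ (Fin n) →L[ℝ] ℝ).continuous.tendsto 0).comp hx
        simpa [Function.comp_def] using this
      exact_mod_cast (Complex.continuous_ofReal.tendsto 0).comp h1
    rw [← map_one v]
    exact boundedGerms_valuation_lt (g := 1) (by simp) ((isLittleO_one_iff ℂ).2 this)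
  have hE : ∀ k, v (E k) < v (X m) := by
    intro k
    have hEk : E k = ((fun i => ((x i k - u k * x i m : ℝ) : ℂ) : ι → ℂ) : K) := by
      simp only [E, Germ.algebraMap_eq_const, K]
      push_cast
      rfl
    rw [hEk]
    refine boundedGerms_valuation_lt hXm ?_
    refine IsLittleO.of_norm_norm ?_
    simp only [Complex.norm_real]
    refine IsLittleO.norm_norm ?_
    rw [isLittleO_iff_tendsto' (hm.mono fun i hi h => absurd h hi.1)]
    have := (hu k).sub_const (u k)
    rw [sub_self] at this
    refine this.congr' (hm.mono fun i hi => ?_)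
    field_simp [hi.1]
  obtain ⟨δ, hδs, hδ⟩ := exists_derivation_forall_map_le (v := v)
    (fun c hc => boundedGerms_valuation_algebraMap hc) hs0 hs
    (Finset.univ.image E ∪ Finset.univ.image fun j => MvPolynomial.aeval X (P j))
  have hδX : ∀ k, v (δ (X k) - X k) < v (X m) := by
    intro k
    have h0 : δ (algebraMap ℝ K (u k)) = 0 := δ.map_algebraMap (u k)
    have h1 : δ (X k) - X k = δ (E k) - E k := by
      simp only [E, map_sub, Derivation.leibniz, h0, hδs, smul_eq_mul]
      ring
    rw [h1]
    exact (v.map_sub _ _).trans_lt (max_lt ((hδ _ (Finset.mem_union_left _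
      (Finset.mem_image_of_mem _ (Finset.mem_univ k)))).trans_lt (hE k)) (hE k))
  have hy : ∀ k, ∃ y : ι → ℂ, (y : K) = δ (X k) := fun k => Quot.exists_rep _
  choose y hy using hy
  refine ⟨fun i => WithLp.toLp 2 fun k => (y k i).re, ?_, fun j => ?_⟩
  · refine isLittleO_euclideanSpace fun k => ?_
    have h1 := hδX k
    rw [← hy k] at h1
    have h2 : (fun i => y k i - (x i k : ℂ)) =o[φ] fun i => (x i m : ℂ) :=
      isLittleO_of_boundedGerms_valuation_lt h1
    refine (IsBigO.of_bound 1 (Eventually.of_forall fun i => ?_)).trans_isLittleO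
      (h2.trans_isBigO (IsBigO.of_bound 1 (Eventually.of_forall fun i => ?_)))
    · rw [one_mul]
      refine le_trans (le_of_eq ?_) (Complex.abs_re_le_norm _)
      simp
    · simpa using PiLp.norm_apply_le (x i) m
  · have h1 := hδ _ (Finset.mem_union_right _
      (Finset.mem_image_of_mem (fun j => MvPolynomial.aeval X (P j)) (Finset.mem_univ j)))
    rw [δ.map_mvPolynomial_aeval] at h1
    have h2 : ∑ k, MvPolynomial.aeval X (MvPolynomial.pderiv k (P j)) * δ (X k)
        = ((fun i => ∑ k, (MvPolynomial.eval (x i) (MvPolynomial.pderiv k (P j)) : ℂ) * y k i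
            : ι → ℂ) : K) := by
      simp only [← hy]
      rw [show ∀ g : Fin n → ι → ℂ, ((fun i => ∑ k, g k i : ι → ℂ) : K) = ∑ k, (g k : K) from
        fun g => by
          rw [← Finset.sum_fn]
          exact map_sum (Germ.coeRingHom (φ : Filter ι)) g _]
      refine Finset.sum_congr rfl fun k _ => ?_
      rw [show MvPolynomial.aeval X (MvPolynomial.pderiv k (P j)) = _ from
        Germ.aeval_coe (fun i => x i) _]
      rfl
    have h3 : MvPolynomial.aeval X (P j)
        = ((fun i => (MvPolynomial.eval (x i) (P j) : ℂ) : ι → ℂ) : K) :=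
      Germ.aeval_coe (fun i => x i) (P j)
    rw [h2, h3, boundedGerms_valuation_le_iff] at h1
    refine IsBigO.trans (IsBigO.of_bound 1 (Eventually.of_forall fun i => ?_))
      (h1.trans (IsBigO.of_bound 1 (Eventually.of_forall fun i => ?_)))
    · rw [one_mul]
      refine le_trans (le_of_eq ?_) (Complex.abs_re_le_norm _)
      simp [Complex.re_sum]
    · simp

end TangentLift

section TaylorPolynomial

open Filter Topology Asymptotics

universe u

variable {E F : Type*} [NormedAddCommGroup E] [NormedSpace ℝ E]
  [NormedAddCommGroup F] [NormedSpace ℝ F]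

/-- The iterated derivatives of a `C^m` map are symmetric. -/
theorem ContDiffAt.iteratedFDeriv_apply_comp_perm {g : E → F} {m : ℕ} {x : E}
    (hg : ContDiffAt ℝ m g x) (σ : Equiv.Perm (Fin m)) (v : Fin m → E) :
    iteratedFDeriv ℝ m g x (v ∘ σ) = iteratedFDeriv ℝ m g x v := by
  induction m generalizing x with
  | zero => exact congrArg _ (Subsingleton.elim _ _)
  | succ m ih =>
    have hσ : σ ∈ Submonoid.closure
        (Set.range fun i : Fin m => Equiv.swap i.castSucc i.succ) := by
      rw [Equiv.Perm.mclosure_swap_castSucc_succ]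
      trivial
    induction hσ using Submonoid.closure_induction generalizing v with
    | one => rfl
    | mul s t _ _ hs ht => exact (ht (v ∘ s)).trans (hs v)
    | mem s h =>
      obtain ⟨i, rfl⟩ := h
      obtain _ | m := m
      · exact i.elim0
      have hd : DifferentiableAt ℝ (iteratedFDeriv ℝ (m + 1) g) x :=
        hg.differentiableAt_iteratedFDeriv (by norm_cast; exact Nat.lt_succ_self _)
      refine Fin.cases ?_ (fun i => ?_) i
      · have h2 : ContDiffAt ℝ 2 (iteratedFDeriv ℝ m g) x :=
          hg.iteratedFDeriv_right (by norm_cast; omega)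
        have hsym := h2.isSymmSndFDerivAt (by simp)
        have key : ∀ u : Fin (m + 2) → E, iteratedFDeriv ℝ (m + 2) g x u
            = fderiv ℝ (fderiv ℝ (iteratedFDeriv ℝ m g)) x (u 0) (u 1)
              (Fin.tail (Fin.tail u)) := fun u => by
          have hd2 : DifferentiableAt ℝ (fderiv ℝ (iteratedFDeriv ℝ m g)) x :=
            (h2.fderiv_right (m := 1) (by norm_num)).differentiableAt (by simp)
          have h := hd.hasFDerivAt.continuousMultilinear_apply_const (Fin.tail u)
          have h' := (hd2.hasFDerivAt.clm_apply (hasFDerivAt_const (u 1) x))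
            |>.continuousMultilinear_apply_const (Fin.tail (Fin.tail u))
          rw [iteratedFDeriv_succ_apply_left]
          simpa using DFunLike.congr_fun (h.unique h') (u 0)
        rw [key, key, ← hsym]
        have e : Fin.tail (Fin.tail (v ∘ Equiv.swap (Fin.castSucc 0) (Fin.succ 0)))
            = Fin.tail (Fin.tail v) := by
          funext k
          simp only [Fin.tail, Function.comp_apply]
          rw [Equiv.swap_apply_of_ne_of_ne] <;> simp [Fin.ext_iff]
        rw [e]
        simp
      · have e0 : (v ∘ Equiv.swap i.succ.castSucc i.succ.succ) 0 = v 0 := by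
          rw [Function.comp_apply, Equiv.swap_apply_of_ne_of_ne] <;> simp [Fin.ext_iff]
        have e1 : Fin.tail (v ∘ Equiv.swap i.succ.castSucc i.succ.succ)
            = Fin.tail v ∘ Equiv.swap i.castSucc i.succ := by
          funext k
          simp only [Fin.tail, Function.comp_apply, ← Fin.succ_castSucc]
          rw [(Fin.succ_injective _).swap_apply]
        rw [iteratedFDeriv_succ_apply_left, iteratedFDeriv_succ_apply_left, e0, e1]
        have hev : ∀ᶠ y in 𝓝 x, iteratedFDeriv ℝ (m + 1) g y
              (Fin.tail v ∘ Equiv.swap i.castSucc i.succ)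
            = iteratedFDeriv ℝ (m + 1) g y (Fin.tail v) := by
          filter_upwards [hg.eventually (by simp)] with y hy
          exact ih (hy.of_le (by norm_cast; omega)) _ _
        have hfd : ∀ u : Fin (m + 1) → E,
            fderiv ℝ (fun y => iteratedFDeriv ℝ (m + 1) g y u) x
              = (ContinuousMultilinearMap.apply ℝ (fun _ : Fin (m + 1) => E) F u).comp
                (fderiv ℝ (iteratedFDeriv ℝ (m + 1) g) x) := fun u =>
          ((ContinuousMultilinearMap.apply ℝ (fun _ : Fin (m + 1) => E) F u).hasFDerivAt.comp x
            hd.hasFDerivAt).fderiv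
        have := Filter.EventuallyEq.fderiv_eq (𝕜 := ℝ) hev
        rw [hfd, hfd] at this
        exact DFunLike.congr_fun this (v 0)

/-- A `C^r` map whose derivatives up to order `r` vanish at `0` is `o(‖x‖ ^ r)`. -/
theorem ContDiffAt.isLittleO_norm_pow {E F : Type u} [NormedAddCommGroup E] [NormedSpace ℝ E]
    [NormedAddCommGroup F] [NormedSpace ℝ F] {g : E → F} {r : ℕ} (hg : ContDiffAt ℝ r g 0)
    (h0 : ∀ k ≤ r, iteratedFDeriv ℝ k g 0 = 0) :
    g =o[𝓝 0] fun x => ‖x‖ ^ r := by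
  induction r generalizing F with
  | zero =>
    simp only [pow_zero, isLittleO_one_iff]
    have h1 := hg.continuousAt.tendsto
    have h2 := h0 0 le_rfl
    rw [← norm_eq_zero, norm_iteratedFDeriv_zero, norm_eq_zero] at h2
    rwa [h2] at h1
  | succ r ih =>
    have h1 : fderiv ℝ g =o[𝓝 0] fun x => ‖x‖ ^ r := by
      refine ih (hg.fderiv_right (m := r) (by norm_cast)) fun k hk => ?_
      rw [← norm_eq_zero, norm_iteratedFDeriv_fderiv, h0 _ (by omega), norm_zero]
    have hg0 : g 0 = 0 := by
      have h2 := h0 0 (Nat.zero_le _)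
      rwa [← norm_eq_zero, norm_iteratedFDeriv_zero, norm_eq_zero] at h2
    have hdiff : ∀ᶠ x in 𝓝 (0 : E), DifferentiableAt ℝ g x := by
      filter_upwards [hg.eventually (by simp)] with y hy
      exact hy.differentiableAt (by simp)
    refine isLittleO_iff.2 fun c hc => ?_
    obtain ⟨ε, hε, hb⟩ := Metric.eventually_nhds_iff_ball.1 (hdiff.and (isLittleO_iff.1 h1 hc))
    filter_upwards [Metric.ball_mem_nhds (0 : E) hε] with x hx
    have hsub : Metric.closedBall (0 : E) ‖x‖ ⊆ Metric.ball 0 ε :=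
      Metric.closedBall_subset_ball (by simpa using hx)
    have := (convex_closedBall (0 : E) ‖x‖).norm_image_sub_le_of_norm_fderiv_le (𝕜 := ℝ)
      (f := g) (C := c * ‖x‖ ^ r) (x := 0) (y := x) (fun y hy => (hb y (hsub hy)).1)
      (fun y hy => ((hb y (hsub hy)).2).trans (by
        rw [norm_pow, norm_norm]
        have : ‖y‖ ≤ ‖x‖ := by simpa using hy
        gcongr)) (by simp) (by simp)
    rw [hg0, sub_zero, sub_zero] at this
    simpa [pow_succ, mul_assoc] using this

theorem MvPolynomial.hasFDerivAt_eval {n : ℕ} (P : MvPolynomial (Fin n) ℝ)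
    (x : EuclideanSpace ℝ (Fin n)) :
    HasFDerivAt (fun y : EuclideanSpace ℝ (Fin n) => MvPolynomial.eval y P)
      (∑ k, MvPolynomial.eval x (MvPolynomial.pderiv k P) •
        (EuclideanSpace.proj k : EuclideanSpace ℝ (Fin n) →L[ℝ] ℝ)) x := by
  induction P using MvPolynomial.induction_on with
  | C a => simpa using hasFDerivAt_const a x
  | add p q hp hq =>
    refine ((hp.add hq).congr_fderiv ?_).congr_of_eventuallyEq (.of_forall fun y => ?_)
    · simp [add_smul, Finset.sum_add_distrib]
    · simp
  | mul_X p i hp =>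
    have h := hp.mul (EuclideanSpace.proj i :
      EuclideanSpace ℝ (Fin n) →L[ℝ] ℝ).hasFDerivAt
    refine (h.congr_fderiv ?_).congr_of_eventuallyEq (.of_forall fun y => ?_)
    · ext w
      simp [MvPolynomial.pderiv_X, Pi.single_apply, add_mul, Finset.sum_add_distrib,
        Finset.mul_sum, mul_assoc, apply_ite]
    · simp

theorem ContinuousMultilinearMap.exists_mvPolynomial {n k : ℕ}
    (q : EuclideanSpace ℝ (Fin n) [×k]→L[ℝ] ℝ) :
    ∃ P : MvPolynomial (Fin n) ℝ, ∀ x : EuclideanSpace ℝ (Fin n),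
      MvPolynomial.eval x P = q fun _ => x := by
  refine ⟨∑ σ : Fin k → Fin n, MvPolynomial.C (q fun i => EuclideanSpace.single (σ i) 1) *
    ∏ i, MvPolynomial.X (σ i), fun x => ?_⟩
  have hx : x = ∑ j, x j • EuclideanSpace.single j (1 : ℝ) := by
    ext k
    simp [Pi.single_apply]
  conv_rhs => rw [hx]
  rw [q.map_sum]
  simp [q.map_smul_univ, mul_comm]

/-- **Taylor's theorem** in several variables, for a map and its derivative. -/
theorem ContDiffAt.exists_mvPolynomial_isLittleO {n r : ℕ} {g : EuclideanSpace ℝ (Fin n) → ℝ}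
    (hg : ContDiffAt ℝ (r + 1 : ℕ) g 0) :
    ∃ P : MvPolynomial (Fin n) ℝ,
      ((fun x => g x - MvPolynomial.eval x P) =o[𝓝 0] fun x => ‖x‖ ^ (r + 1)) ∧
      (fun x => fderiv ℝ g x - ∑ k, MvPolynomial.eval x (MvPolynomial.pderiv k P) •
        (EuclideanSpace.proj k : EuclideanSpace ℝ (Fin n) →L[ℝ] ℝ))
          =o[𝓝 0] fun x => ‖x‖ ^ r := by
  let p : FormalMultilinearSeries ℝ (EuclideanSpace ℝ (Fin n)) ℝ := fun k =>
    if k ≤ r + 1 then ((k.factorial : ℝ)⁻¹) • iteratedFDeriv ℝ k g 0 else 0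
  choose Q hQ using fun k => ContinuousMultilinearMap.exists_mvPolynomial (p k)
  let P := ∑ k ∈ Finset.range (r + 2), Q k
  have hP : HasFPowerSeriesOnBall
      (fun x : EuclideanSpace ℝ (Fin n) => MvPolynomial.eval x P) p 0 ⊤ := by
    refine (HasFiniteFPowerSeriesOnBall.mk' (n := r + 2) (fun m hm => if_neg (by omega))
      ENNReal.zero_lt_top fun y _ => ?_).toHasFPowerSeriesOnBall
    rw [zero_add, map_sum]
    exact Finset.sum_congr rfl fun k _ => (hQ k y).symm
  have hPs : ∀ x, HasFDerivAt (fun y : EuclideanSpace ℝ (Fin n) => MvPolynomial.eval y P) _ x :=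
    P.hasFDerivAt_eval
  have hPc : ContDiffAt ℝ (r + 1 : ℕ)
      (fun x : EuclideanSpace ℝ (Fin n) => MvPolynomial.eval x P) 0 :=
    hP.analyticAt.contDiffAt
  have hPd : ∀ k ≤ r + 1,
      iteratedFDeriv ℝ k (fun x : EuclideanSpace ℝ (Fin n) => MvPolynomial.eval x P) 0
        = iteratedFDeriv ℝ k g 0 := fun k hk => by
    ext v
    rw [hP.iteratedFDeriv_eq_sum_of_completeSpace]
    have hgk : ContDiffAt ℝ k g 0 := hg.of_le (by exact_mod_cast hk)
    have : ∀ σ : Equiv.Perm (Fin k), p k (fun i => v (σ i))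
        = (k.factorial : ℝ)⁻¹ * iteratedFDeriv ℝ k g 0 v := fun σ => by
      rw [← hgk.iteratedFDeriv_apply_comp_perm σ v]
      simp only [p, if_pos hk]
      rfl
    have hk0 : (k.factorial : ℝ) ≠ 0 := by positivity
    simp [this, Fintype.card_perm, hk0]
  have hd : ContDiffAt ℝ (r + 1 : ℕ)
      (fun x : EuclideanSpace ℝ (Fin n) => g x - MvPolynomial.eval x P) 0 := hg.sub hPc
  have h0 : ∀ k ≤ r + 1, iteratedFDeriv ℝ k
      (fun x : EuclideanSpace ℝ (Fin n) => g x - MvPolynomial.eval x P) 0 = 0 := fun k hk => by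
    have hk' : (k : WithTop ℕ∞) ≤ (r + 1 : ℕ) := by exact_mod_cast hk
    exact (iteratedFDeriv_sub_apply (hg.of_le hk') (hPc.of_le hk')).trans
      (by rw [hPd k hk, sub_self])
  refine ⟨P, hd.isLittleO_norm_pow h0, ?_⟩
  have h1 := (hd.fderiv_right (m := r) (by norm_cast)).isLittleO_norm_pow fun k hk => by
    rw [← norm_eq_zero, norm_iteratedFDeriv_fderiv, h0 _ (by omega), norm_zero]
  refine h1.congr' ?_ .rfl
  filter_upwards [hg.eventually (by simp)] with y hy
  exact ((hy.differentiableAt (by simp)).hasFDerivAt.sub (hPs y)).fderiv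

end TaylorPolynomial

section BorderedMinors

open Filter Topology Asymptotics

/-- The matrix `A` with the additional last row `v`. -/
def Matrix.addRow {R : Type*} {p n : ℕ} (A : Matrix (Fin p) (Fin n) R) (v : Fin n → R) :
    Matrix (Fin (p + 1)) (Fin n) R :=
  Matrix.of (Fin.snoc (α := fun _ => Fin n → R) A v)

@[simp]
theorem Matrix.addRow_castSucc {R : Type*} {p n : ℕ} (A : Matrix (Fin p) (Fin n) R)
    (v : Fin n → R) (j : Fin p) (k : Fin n) : A.addRow v j.castSucc k = A j k :=
  congrFun (Fin.snoc_castSucc (α := fun _ => Fin n → R) v A j) k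

@[simp]
theorem Matrix.addRow_last {R : Type*} {p n : ℕ} (A : Matrix (Fin p) (Fin n) R)
    (v : Fin n → R) (k : Fin n) : A.addRow v (Fin.last p) k = v k :=
  congrFun (Fin.snoc_last (α := fun _ => Fin n → R) v A) k

theorem Matrix.det_addRow_submatrix {R : Type*} [CommRing R] {p n : ℕ}
    (A : Matrix (Fin p) (Fin n) R) (v : Fin n → R) (ι : Fin (p + 1) → Fin n) :
    ((A.addRow v).submatrix id ι).det = ∑ c : Fin (p + 1),
      (-1) ^ (p + c : ℕ) * v (ι c) * (A.submatrix id (ι ∘ c.succAbove)).det := by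
  rw [Matrix.det_succ_row _ (Fin.last p)]
  refine Finset.sum_congr rfl fun c _ => ?_
  congr 2
  · simp
  · ext j k
    simp

/-- Pairing the minors of `A.addRow v` that extend a fixed set of columns with a vector `w`. -/
theorem Matrix.sum_mul_det_addRow_submatrix_snoc {R : Type*} [CommRing R] {p n : ℕ}
    (A : Matrix (Fin p) (Fin n) R) (v w : Fin n → R) (ι : Fin p → Fin n) :
    ∑ k, w k * ((A.addRow v).submatrix id (Fin.snoc (α := fun _ => Fin n) ι k)).det
      = ∑ j : Fin p, (-1) ^ (j + p : ℕ) *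
          ((A.addRow v).submatrix j.castSucc.succAbove ι).det * ∑ k, A j k * w k
        + (A.submatrix id ι).det * ∑ k, v k * w k := by
  have h : ∀ k, ((A.addRow v).submatrix id (Fin.snoc (α := fun _ => Fin n) ι k)).det
      = ∑ j : Fin p, (-1) ^ (j + p : ℕ) *
          ((A.addRow v).submatrix j.castSucc.succAbove ι).det * A j k
        + (A.submatrix id ι).det * v k := fun k => by
    rw [Matrix.det_succ_column _ (Fin.last p), Fin.sum_univ_castSucc]
    congr 1
    · refine Finset.sum_congr rfl fun j _ => ?_
      have : (((A.addRow v).submatrix id (Fin.snoc (α := fun _ => Fin n) ι k)).submatrix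
          j.castSucc.succAbove (Fin.last p).succAbove)
          = (A.addRow v).submatrix j.castSucc.succAbove ι := by
        ext a b
        simp
      rw [this]
      simp only [Fin.val_castSucc, Fin.val_last, submatrix_apply, id_eq, Fin.snoc_last,
        addRow_castSucc]
      ring
    · have : (((A.addRow v).submatrix id (Fin.snoc (α := fun _ => Fin n) ι k)).submatrix
          (Fin.last p).succAbove (Fin.last p).succAbove) = A.submatrix id ι := by
        ext a b
        simp
      rw [this]
      simp only [Fin.val_last, submatrix_apply, id_eq, Fin.snoc_last, addRow_last]
      rw [Even.neg_one_pow ⟨p, rfl⟩]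
      ring
  simp only [h, mul_add, Finset.sum_add_distrib, Finset.mul_sum]
  congr 1
  · rw [Finset.sum_comm]
    exact Finset.sum_congr rfl fun _ _ => Finset.sum_congr rfl fun _ _ => by ring
  · exact Finset.sum_congr rfl fun _ _ => by ring

/-- Up to sign, every maximal minor vanishes or has increasing columns. -/
theorem Matrix.abs_det_submatrix_eq_zero_or {m n : ℕ} (A : Matrix (Fin m) (Fin n) ℝ)
    (ι : Fin m → Fin n) :
    (A.submatrix id ι).det = 0 ∨
      StrictMono (ι ∘ Tuple.sort ι) ∧
        |(A.submatrix id ι).det| = |(A.submatrix id (ι ∘ Tuple.sort ι)).det| := by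
  by_cases hι : Function.Injective ι
  · right
    refine ⟨(Tuple.monotone_sort ι).strictMono_of_injective
      (hι.comp (Tuple.sort ι).injective), ?_⟩
    have := Matrix.det_permute' (Tuple.sort ι) (A.submatrix id ι)
    rw [Matrix.submatrix_submatrix] at this
    rw [show (A.submatrix id (ι ∘ Tuple.sort ι)).det = _ from this, abs_mul]
    obtain h | h := Int.units_eq_one_or (Equiv.Perm.sign (Tuple.sort ι)) <;> simp [h]
  · left
    simp only [Function.Injective, not_forall] at hι
    obtain ⟨a, b, hab, hne⟩ := hι
    exact Matrix.det_zero_of_column_eq hne fun k => by simp [hab]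

theorem Asymptotics.isBigO_det {α : Type*} {l : Filter α} {m : ℕ}
    {A : α → Matrix (Fin m) (Fin m) ℝ} {b : Fin m → α → ℝ}
    (h : ∀ i j, (fun a => A a i j) =O[l] b i) :
    (fun a => (A a).det) =O[l] fun a => ∏ i, b i a := by
  simp only [Matrix.det_apply']
  refine IsBigO.fun_sum fun σ _ => (IsBigO.const_mul_left ?_ _)
  have hσ : (fun a => ∏ i, b i a) = fun a => ∏ i, b (σ i) a :=
    funext fun a => (Equiv.prod_comp σ fun i => b i a).symm
  rw [hσ]
  exact IsBigO.finsetProd fun i _ => h _ _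

end BorderedMinors

section KuoThom

open Filter Topology Asymptotics

variable {n p : ℕ}

/-- The Jacobian matrix of `f` at `x`. -/
noncomputable def jacobianMatrix (f : EuclideanSpace ℝ (Fin n) → EuclideanSpace ℝ (Fin p))
    (x : EuclideanSpace ℝ (Fin n)) : Matrix (Fin p) (Fin n) ℝ :=
  Matrix.of fun j k => fderiv ℝ f x (EuclideanSpace.single k 1) j

theorem jacobianMatrix_mul_sum (f : EuclideanSpace ℝ (Fin n) → EuclideanSpace ℝ (Fin p))
    (x w : EuclideanSpace ℝ (Fin n)) (j : Fin p) :
    ∑ k, jacobianMatrix f x j k * w k = fderiv ℝ f x w j := by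
  have hw : w = ∑ k, w k • EuclideanSpace.single k (1 : ℝ) := by
    ext k
    simp [Pi.single_apply]
  conv_rhs => rw [hw]
  simp [jacobianMatrix, mul_comm]

open scoped Classical in
theorem kuoQ_two_eq (f : EuclideanSpace ℝ (Fin n) → EuclideanSpace ℝ (Fin p))
    (x : EuclideanSpace ℝ (Fin n)) :
    KuoQ n p 2 f x = ‖x‖ ^ 2 * ∑ ι : Fin p → Fin n with StrictMono ι,
      ((jacobianMatrix f x).submatrix id ι).det ^ 2 + ‖f x‖ ^ 2 := by
  simp only [KuoQ, sq_abs, Finset.sum_filter]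
  rfl

open scoped Classical in
theorem thomQ_two_eq (f : EuclideanSpace ℝ (Fin n) → EuclideanSpace ℝ (Fin p))
    (x : EuclideanSpace ℝ (Fin n)) :
    ThomQ n p 2 f x = ∑ ι : Fin (p + 1) → Fin n with StrictMono ι,
      (((jacobianMatrix f x).addRow (2 • x)).submatrix id ι).det ^ 2 + ‖f x‖ ^ 2 := by
  simp only [ThomQ, sq_abs, Finset.sum_filter]
  congr 1
  refine Finset.sum_congr rfl fun ι _ => ?_
  congr 3
  ext j k
  refine Fin.lastCases ?_ (fun j => ?_) j
  · simp
  · simp [jacobianMatrix]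

theorem exists_thomQ_two_le_mul_kuoQ_two
    (f : EuclideanSpace ℝ (Fin n) → EuclideanSpace ℝ (Fin p)) :
    ∃ D > 0, ∀ x, ThomQ n p 2 f x ≤ D * KuoQ n p 2 f x := by
  classical
  refine ⟨Fintype.card (Fin (p + 1) → Fin n) * (4 * (p + 1) ^ 2) + 1, by positivity,
    fun x => ?_⟩
  rw [kuoQ_two_eq, thomQ_two_eq]
  set S := ∑ ι : Fin p → Fin n with StrictMono ι,
    ((jacobianMatrix f x).submatrix id ι).det ^ 2
  have hS : 0 ≤ S := Finset.sum_nonneg fun _ _ => sq_nonneg _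
  have key : ∀ ι : Fin (p + 1) → Fin n, StrictMono ι →
      (((jacobianMatrix f x).addRow (2 • x)).submatrix id ι).det ^ 2
        ≤ 4 * (p + 1) ^ 2 * (‖x‖ ^ 2 * S) := fun ι hι => by
    rw [Matrix.det_addRow_submatrix]
    refine sq_sum_le_card_mul_sum_sq.trans ?_
    have hterm : ∀ c : Fin (p + 1), ((-1) ^ (p + c : ℕ) * (2 • x) (ι c) *
        ((jacobianMatrix f x).submatrix id (ι ∘ c.succAbove)).det) ^ 2
          ≤ 4 * (‖x‖ ^ 2 * S) := fun c => by
      have h1 : ((jacobianMatrix f x).submatrix id (ι ∘ c.succAbove)).det ^ 2 ≤ S :=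
        Finset.single_le_sum (f := fun ι : Fin p → Fin n =>
          ((jacobianMatrix f x).submatrix id ι).det ^ 2) (fun _ _ => sq_nonneg _)
          (Finset.mem_filter.2 ⟨Finset.mem_univ _, hι.comp (Fin.strictMono_succAbove c)⟩)
      have h2 : x (ι c) ^ 2 ≤ ‖x‖ ^ 2 := by
        rw [← sq_abs]
        exact pow_le_pow_left₀ (abs_nonneg _) (PiLp.norm_apply_le x (ι c)) 2
      have h3 : ((-1 : ℝ) ^ (p + c : ℕ)) ^ 2 = 1 := by
        rw [← pow_mul, mul_comm, pow_mul, neg_one_sq, one_pow]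
      calc _ = 4 * (x (ι c) ^ 2 *
            ((jacobianMatrix f x).submatrix id (ι ∘ c.succAbove)).det ^ 2) := by
            rw [mul_pow, mul_pow, h3]
            simp
            ring
        _ ≤ _ := by gcongr
    calc _ ≤ ((Finset.univ : Finset (Fin (p + 1))).card : ℝ) *
          ∑ _c : Fin (p + 1), 4 * (‖x‖ ^ 2 * S) := by
          gcongr with c
          exact hterm c
      _ = _ := by
          simp
          ring
  have hsum : ∑ ι : Fin (p + 1) → Fin n with StrictMono ι,
      (((jacobianMatrix f x).addRow (2 • x)).submatrix id ι).det ^ 2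
        ≤ Fintype.card (Fin (p + 1) → Fin n) * (4 * (p + 1) ^ 2 * (‖x‖ ^ 2 * S)) := by
    refine (Finset.sum_le_card_nsmul _ _ _ fun ι hι => key ι (Finset.mem_filter.1 hι).2).trans ?_
    rw [nsmul_eq_mul]
    gcongr
    exact Finset.card_filter_le _ _
  have hxS : 0 ≤ ‖x‖ ^ 2 * S := by positivity
  have hc : 0 ≤ (Fintype.card (Fin (p + 1) → Fin n) : ℝ) * (4 * (p + 1) ^ 2) * ‖f x‖ ^ 2 := by
    positivity
  nlinarith

theorem isBigO_jacobianMatrix {α : Type*} {l : Filter α}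
    {f : EuclideanSpace ℝ (Fin n) → EuclideanSpace ℝ (Fin p)} (hf : ContDiffAt ℝ 1 f 0)
    {x : α → EuclideanSpace ℝ (Fin n)} (hx : Tendsto x l (𝓝 0)) (j : Fin p) (k : Fin n) :
    (fun i => jacobianMatrix f (x i) j k) =O[l] fun _ => (1 : ℝ) := by
  have h1 : ContinuousAt (fderiv ℝ f) 0 := (hf.fderiv_right (m := 0) (by simp)).continuousAt
  refine IsBigO.trans (IsBigO.of_bound 1 (Eventually.of_forall fun i => ?_))
    ((h1.tendsto.comp hx).isBigO_one ℝ)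
  refine (PiLp.norm_apply_le _ j).trans ((ContinuousLinearMap.le_opNorm _ _).trans ?_)
  simp

/-- Along an ultrafilter converging to the origin there are vectors `w` close to `x` in direction
that are annihilated by the differential of `f` up to an error `o(‖x‖ ^ (s + 1))`, as soon as `f`
itself is `o(‖x‖ ^ (s + 1))`. -/
theorem exists_isLittleO_fderiv_apply {α : Type*} {φ : Ultrafilter α} {s : ℕ}
    {f : EuclideanSpace ℝ (Fin n) → EuclideanSpace ℝ (Fin p)}
    (hf : ContDiffAt ℝ (s + 1 : ℕ) f 0) {x : α → EuclideanSpace ℝ (Fin n)}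
    (hx : Tendsto x φ (𝓝 0)) (hx0 : ∀ᶠ i in φ, x i ≠ 0)
    (hfx : (fun i => f (x i)) =o[φ] fun i => ‖x i‖ ^ (s + 1)) :
    ∃ w : α → EuclideanSpace ℝ (Fin n), (fun i => w i - x i) =o[φ] x ∧
      ∀ j, (fun i => fderiv ℝ f (x i) (w i) j) =o[φ] fun i => ‖x i‖ ^ (s + 1) := by
  choose P hP hP' using fun j => ((contDiffAt_piLp 2).1 hf j).exists_mvPolynomial_isLittleO
  obtain ⟨w, hw, hPw⟩ := exists_isLittleO_sub_forall_isBigO_pderiv P hx hx0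
  have hwx : w =O[φ] x := by
    simpa using hw.isBigO.add (isBigO_refl x φ)
  refine ⟨w, hw, fun j => ?_⟩
  have hfj : (fun i => f (x i) j) =o[φ] fun i => ‖x i‖ ^ (s + 1) :=
    (IsBigO.of_bound 1 (Eventually.of_forall fun i => by
      simpa using PiLp.norm_apply_le (f (x i)) j)).trans_isLittleO hfx
  have h1 : (fun i => ∑ k, MvPolynomial.eval (x i) (MvPolynomial.pderiv k (P j)) * w i k)
      =o[φ] fun i => ‖x i‖ ^ (s + 1) := by
    refine (hPw j).trans_isLittleO ?_
    simpa using hfj.sub ((hP j).comp_tendsto hx)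
  have h2 : (fun i => fderiv ℝ (fun y => f y j) (x i) (w i)
      - ∑ k, MvPolynomial.eval (x i) (MvPolynomial.pderiv k (P j)) * w i k)
        =o[φ] fun i => ‖x i‖ ^ (s + 1) := by
    have h3 := ((hP' j).comp_tendsto hx).norm_left.mul_isBigO hwx.norm_norm
    refine (IsBigO.of_bound 1 (Eventually.of_forall fun i => ?_)).trans_isLittleO
      (h3.congr_right fun i => (pow_succ _ _).symm)
    rw [one_mul, norm_mul, norm_norm, norm_norm]
    refine le_trans (le_of_eq ?_) (ContinuousLinearMap.le_opNorm _ _)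
    simp
  have h4 : ∀ᶠ i in φ, fderiv ℝ f (x i) (w i) j = fderiv ℝ (fun y => f y j) (x i) (w i) := by
    filter_upwards [hx.eventually (hf.eventually (by simp))] with i hi
    have hd : DifferentiableAt ℝ f (x i) := hi.differentiableAt (by simp)
    have := ((EuclideanSpace.proj j : EuclideanSpace ℝ (Fin p) →L[ℝ] ℝ).hasFDerivAt.comp (x i)
      hd.hasFDerivAt).fderiv
    exact (DFunLike.congr_fun this (w i)).symm
  refine IsLittleO.congr' (f₁ := fun i => fderiv ℝ (fun y => f y j) (x i) (w i))
    (by simpa using h2.add h1) ?_ .rfl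
  filter_upwards [h4] with i hi using hi.symm

theorem not_thomQ_two_isLittleO {α : Type*} {φ : Ultrafilter α} {s : ℕ}
    {f : EuclideanSpace ℝ (Fin n) → EuclideanSpace ℝ (Fin p)}
    (hf : ContDiffAt ℝ (s + 1 : ℕ) f 0) {x : α → EuclideanSpace ℝ (Fin n)}
    (hx : Tendsto x φ (𝓝 0)) (hx0 : ∀ᶠ i in φ, x i ≠ 0)
    (hK : (fun i => ‖x i‖ ^ (2 * (s + 1))) =O[φ] fun i => KuoQ n p 2 f (x i)) :
    ¬ (fun i => ThomQ n p 2 f (x i)) =o[φ] fun i => ‖x i‖ ^ (2 * (s + 1)) := by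
  classical
  intro hT
  have hpow : (fun i => ‖x i‖ ^ (2 * (s + 1))) = (fun i => ‖x i‖ ^ (s + 1)) ^ 2 := by
    funext i
    rw [Pi.pow_apply, ← pow_mul, mul_comm]
  have hfx : (fun i => f (x i)) =o[φ] fun i => ‖x i‖ ^ (s + 1) := by
    refine IsLittleO.of_norm_left (IsLittleO.of_pow (n := 2) ?_ two_ne_zero)
    rw [← hpow]
    refine (IsBigO.of_bound 1 (Eventually.of_forall fun i => ?_)).trans_isLittleO hT
    have : 0 ≤ ∑ ι : Fin (p + 1) → Fin n with StrictMono ι,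
      (((jacobianMatrix f (x i)).addRow (2 • x i)).submatrix id ι).det ^ 2 :=
      Finset.sum_nonneg fun _ _ => sq_nonneg _
    rw [thomQ_two_eq, Pi.pow_apply, one_mul, norm_pow, norm_norm]
    exact (le_add_of_nonneg_left this).trans (le_abs_self _)
  have hminor : ∀ ι : Fin (p + 1) → Fin n,
      (fun i => (((jacobianMatrix f (x i)).addRow (2 • x i)).submatrix id ι).det)
        =o[φ] fun i => ‖x i‖ ^ (s + 1) := fun ι => by
    refine IsLittleO.of_pow (n := 2) ?_ two_ne_zero
    rw [← hpow]
    refine (IsBigO.of_bound 1 (Eventually.of_forall fun i => ?_)).trans_isLittleO hT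
    rw [one_mul, thomQ_two_eq, Pi.pow_apply, norm_pow, Real.norm_eq_abs]
    refine le_trans ?_ (le_abs_self _)
    obtain h | ⟨hι, h⟩ := Matrix.abs_det_submatrix_eq_zero_or
      ((jacobianMatrix f (x i)).addRow (2 • x i)) ι
    · rw [h, abs_zero, zero_pow two_ne_zero]
      positivity
    · rw [h, sq_abs]
      exact le_add_of_le_of_nonneg (Finset.single_le_sum (f := fun ι : Fin (p + 1) → Fin n =>
          (((jacobianMatrix f (x i)).addRow (2 • x i)).submatrix id ι).det ^ 2)
          (fun _ _ => sq_nonneg _) (Finset.mem_filter.2 ⟨Finset.mem_univ _, hι⟩)) (sq_nonneg _)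
  obtain ⟨I, hI⟩ : ∃ I : Fin p → Fin n, (fun i => ‖x i‖ ^ s)
      =O[φ] fun i => ((jacobianMatrix f (x i)).submatrix id I).det := by
    have hS : (fun i => ‖x i‖ ^ (2 * (s + 1))) =O[φ] fun i => ‖x i‖ ^ 2 *
        ∑ ι : Fin p → Fin n with StrictMono ι,
          ((jacobianMatrix f (x i)).submatrix id ι).det ^ 2 := by
      have h1 : (fun i => ‖f (x i)‖ ^ 2) =o[φ] fun i => ‖x i‖ ^ (2 * (s + 1)) := by
        rw [hpow]
        exact hfx.norm_left.pow two_pos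
      have h2 := hK
      simp only [kuoQ_two_eq] at h2
      obtain ⟨c, hc, h2⟩ := h2.exists_pos
      refine IsBigO.of_bound (2 * c) ?_
      filter_upwards [h2.bound, h1.bound (show 0 < (2 * c)⁻¹ by positivity)] with i hi hi'
      have h3 := hi.trans (mul_le_mul_of_nonneg_left (norm_add_le _ _) hc.le)
      have h4 := mul_le_mul_of_nonneg_left hi' hc.le
      have h5 : c * ((2 * c)⁻¹ * ‖‖x i‖ ^ (2 * (s + 1))‖) = ‖‖x i‖ ^ (2 * (s + 1))‖ / 2 := by
        field_simp
      rw [h5] at h4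
      linarith
    have hS' : (fun i => ‖x i‖ ^ (2 * s)) =O[φ] fun i => ∑ ι : Fin p → Fin n with StrictMono ι,
          ((jacobianMatrix f (x i)).submatrix id ι).det ^ 2 := by
      obtain ⟨c, hc⟩ := hS.bound
      refine IsBigO.of_bound c ?_
      filter_upwards [hc, hx0] with i hi hi0
      have h3 : 0 < ‖x i‖ ^ 2 := by positivity
      rw [mul_add, pow_add, norm_mul, norm_mul] at hi
      simp only [mul_one, norm_pow, norm_norm] at hi ⊢
      nlinarith
    obtain ⟨I, hI⟩ := Ultrafilter.exists_eventually_of_finite (φ := φ)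
      (p := fun (I : Fin p → Fin n) i => ∑ ι : Fin p → Fin n with StrictMono ι,
          ((jacobianMatrix f (x i)).submatrix id ι).det ^ 2
        ≤ Fintype.card (Fin p → Fin n) * ((jacobianMatrix f (x i)).submatrix id I).det ^ 2) (by
      filter_upwards [hx0] with i hi
      obtain ⟨k⟩ : Nonempty (Fin n) := by
        by_contra hn
        rw [not_nonempty_iff] at hn
        exact hi (Subsingleton.elim _ _)
      obtain ⟨I, -, hI⟩ := Finset.exists_max_image (Finset.univ : Finset (Fin p → Fin n))
        (fun ι => ((jacobianMatrix f (x i)).submatrix id ι).det ^ 2) ⟨fun _ => k, Finset.mem_univ _⟩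
      refine ⟨I, (Finset.sum_le_card_nsmul _ _ _ fun ι _ => hI ι (Finset.mem_univ _)).trans ?_⟩
      rw [nsmul_eq_mul]
      gcongr
      exact Finset.card_filter_le _ _)
    refine ⟨I, IsBigO.of_pow two_ne_zero ((hS'.trans (IsBigO.of_bound
      (Fintype.card (Fin p → Fin n) : ℝ) ?_)).congr_left
      fun i => by rw [Pi.pow_apply, ← pow_mul, mul_comm])⟩
    filter_upwards [hI] with i hi
    rw [Pi.pow_apply, Real.norm_of_nonneg (Finset.sum_nonneg fun _ _ => sq_nonneg _),
      Real.norm_of_nonneg (sq_nonneg _)]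
    exact hi
  obtain ⟨w, hw, hJw⟩ := exists_isLittleO_fderiv_apply hf hx hx0 hfx
  have hwx : w =O[φ] x := by
    simpa using hw.isBigO.add (isBigO_refl x φ)
  have hcoord : ∀ {z : α → EuclideanSpace ℝ (Fin n)} (k : Fin n),
      (fun i => z i k) =O[φ] fun i => ‖z i‖ := fun {z} k =>
    IsBigO.of_bound 1 (Eventually.of_forall fun i => by
      simpa using PiLp.norm_apply_le (z i) k)
  -- the bordered minors containing the columns `I`, paired with `w`
  have hpair : (fun i => ∑ k, w i k * (((jacobianMatrix f (x i)).addRow (2 • x i)).submatrix id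
      (Fin.snoc (α := fun _ => Fin n) I k)).det) =o[φ] fun i => ‖x i‖ * ‖x i‖ ^ (s + 1) :=
    IsLittleO.fun_sum fun k _ =>
      ((hcoord k).trans hwx.norm_norm).mul_isLittleO (hminor _)
  have hrest : (fun i => ∑ j : Fin p, (-1) ^ (j + p : ℕ) *
      (((jacobianMatrix f (x i)).addRow (2 • x i)).submatrix j.castSucc.succAbove I).det *
        ∑ k, jacobianMatrix f (x i) j k * w i k) =o[φ] fun i => ‖x i‖ * ‖x i‖ ^ (s + 1) := by
    refine IsLittleO.fun_sum fun j _ => ?_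
    simp only [jacobianMatrix_mul_sum, mul_assoc]
    refine IsLittleO.const_mul_left (IsBigO.mul_isLittleO ?_ (hJw j)) _
    let b : Fin (p + 1) → α → ℝ := Fin.snoc (α := fun _ => α → ℝ) (fun _ _ => 1) fun i => ‖x i‖
    have hb : ∀ a k, (fun i => (jacobianMatrix f (x i)).addRow (2 • x i) a k) =O[φ] b a := by
      intro a k
      refine Fin.lastCases ?_ (fun a => ?_) a
      · simpa [b] using (hcoord (z := x) k).const_mul_left 2
      · simpa [b] using isBigO_jacobianMatrix (hf.of_le (by simp)) hx a k
    have hprod : (fun i => ∏ a, b (j.castSucc.succAbove a) i) = fun i => ‖x i‖ := by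
      funext i
      have h1 := Fin.prod_univ_succAbove (fun a => b a i) j.castSucc
      rw [Fin.prod_univ_castSucc] at h1
      simpa [b] using h1.symm
    rw [← hprod]
    exact isBigO_det fun a k => hb _ _
  have hmain : (fun i => ((jacobianMatrix f (x i)).submatrix id I).det * ∑ k, (2 • x i) k * w i k)
      =o[φ] fun i => ‖x i‖ * ‖x i‖ ^ (s + 1) := by
    refine (hpair.sub hrest).congr_left fun i => ?_
    rw [Matrix.sum_mul_det_addRow_submatrix_snoc, add_sub_cancel_left]
    rfl
  have hinner : (fun i => ‖x i‖ ^ 2) =O[φ] fun i => ∑ k, (2 • x i) k * w i k := by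
    refine IsBigO.of_bound 1 ?_
    filter_upwards [hw.bound one_half_pos] with i hi
    have h1 : ∑ k, (2 • x i) k * w i k = 2 * inner ℝ (x i) (w i) := by
      simp [PiLp.inner_apply, Finset.mul_sum, mul_assoc, mul_comm]
    have h2 : inner ℝ (x i) (w i) = ‖x i‖ ^ 2 + inner ℝ (x i) (w i - x i) := by
      rw [inner_sub_right, real_inner_self_eq_norm_sq]
      ring
    have h3 := abs_real_inner_le_norm (x i) (w i - x i)
    have h4 : ‖x i‖ * ‖w i - x i‖ ≤ ‖x i‖ * (1 / 2 * ‖x i‖) := by gcongr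
    have h5 := (abs_le.1 h3).1
    rw [h1, one_mul, Real.norm_of_nonneg (by positivity)]
    refine le_trans ?_ (le_abs_self _)
    rw [h2]
    nlinarith
  have hfinal := (hI.mul hinner).trans_isLittleO hmain
  refine isLittleO_irrefl ?_ (hfinal.congr_right fun i =>
    show ‖x i‖ * ‖x i‖ ^ (s + 1) = ‖x i‖ ^ s * ‖x i‖ ^ 2 by ring)
  refine Eventually.frequently ?_
  filter_upwards [hx0] with i hi
  have := norm_ne_zero_iff.2 hi
  positivity

end KuoThom

theorem kuo2_iff_thom2_lower_bound (r : ℕ) (hr : 0 < r) (n p : ℕ) (hp : 1 ≤ p) (hpn : p ≤ n)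
    (f : EuclideanSpace ℝ (Fin n) → EuclideanSpace ℝ (Fin p))
    (U : Set (EuclideanSpace ℝ (Fin n))) (hU : U ∈ nhds 0)
    (hf : ContDiffOn ℝ r f U) (hf0 : f 0 = 0) :
    (∃ C > (0 : ℝ), ∃ α > (0 : ℝ), ∀ x : EuclideanSpace ℝ (Fin n),
        ‖x‖ < α → C * ‖x‖ ^ (2 * r) ≤ KuoQ n p 2 f x) ↔
    (∃ K > (0 : ℝ), ∃ β > (0 : ℝ), ∀ x : EuclideanSpace ℝ (Fin n),
        ‖x‖ < β → K * ‖x‖ ^ (2 * r) ≤ ThomQ n p 2 f x) := by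
  obtain ⟨s, rfl⟩ : ∃ s, r = s + 1 := ⟨r - 1, by omega⟩
  have hfa : ContDiffAt ℝ (s + 1 : ℕ) f 0 := hf.contDiffAt hU
  constructor
  · rintro ⟨C, hC, α, hα, hK⟩
    by_contra! hT
    choose x hxβ hxT using fun i : ℕ =>
      hT (1 / ((i : ℝ) + 1)) Nat.one_div_pos_of_nat (1 / ((i : ℝ) + 1)) Nat.one_div_pos_of_nat
    have h0 : Filter.Tendsto (fun i : ℕ => 1 / ((i : ℝ) + 1)) (Filter.hyperfilter ℕ) (nhds 0) :=
      tendsto_one_div_add_atTop_nhds_zero_nat.mono_left Nat.hyperfilter_le_atTop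
    have hT0 : ∀ i, 0 ≤ ThomQ n p 2 f (x i) := fun i => by
      rw [thomQ_two_eq]
      positivity
    have hx : Filter.Tendsto x (Filter.hyperfilter ℕ) (nhds 0) :=
      squeeze_zero_norm (fun i => (hxβ i).le) h0
    have hx0 : ∀ i, x i ≠ 0 := fun i hi => by
      have h := (hT0 i).trans_lt (hxT i)
      simp [hi] at h
    refine not_thomQ_two_isLittleO hfa hx (.of_forall hx0) ?_ ?_
    · refine Asymptotics.IsBigO.of_bound C⁻¹ ?_
      filter_upwards [hx.norm.eventually (gt_mem_nhds (by simpa using hα))] with i hi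
      rw [Real.norm_of_nonneg (by positivity), inv_mul_eq_div, le_div_iff₀' hC]
      exact (hK _ hi).trans (le_abs_self _)
    · refine Asymptotics.IsLittleO.of_bound fun c hc => ?_
      filter_upwards [h0.eventually (gt_mem_nhds hc)] with i hi
      rw [Real.norm_of_nonneg (hT0 i), Real.norm_of_nonneg (by positivity)]
      exact (hxT i).le.trans (by gcongr)
  · rintro ⟨K, hK, β, hβ, hT⟩
    obtain ⟨D, hD, hTK⟩ := exists_thomQ_two_le_mul_kuoQ_two f
    refine ⟨K / D, div_pos hK hD, β, hβ, fun x hx => ?_⟩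
    rw [div_mul_eq_mul_div, div_le_iff₀' hD]
    exact (hT x hx).trans (hTK x)
end

section
/- There exist constants C, δ > 0 such that for all (x,y) ∈ ℝ² with x² + y² ≤ δ², one has 16(x² + y²)x²y² ≤ C·((x − y²)² + x⁴). Consequently, for the polynomial map f(x,y) = (x − y², x²) one has K_2(f,·) ≈ T_2(f,·), where K_2(f,(x,y)) = 16(x² + y²)x²y² + (x − y²)² + x⁴ and T_2(f,(x,y)) = (x − y²)² + x⁴. -/
/-- `K_2(f,(x,y))` for `f(x,y) = (x - y², x²)`. -/
noncomputable def exampleK2 (x y : ℝ) : ℝ :=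
  16 * (x ^ 2 + y ^ 2) * x ^ 2 * y ^ 2 + (x - y ^ 2) ^ 2 + x ^ 4

/-- `T_2(f,(x,y))` for `f(x,y) = (x - y², x²)`. -/
noncomputable def exampleT2 (x y : ℝ) : ℝ :=
  (x - y ^ 2) ^ 2 + x ^ 4

/-- The Jacobian term of `K_2` is dominated by `T_2` on the unit disc. -/
theorem jacobian_term_le (x y : ℝ) (h : x ^ 2 + y ^ 2 ≤ 1) :
    16 * (x ^ 2 + y ^ 2) * x ^ 2 * y ^ 2 ≤ 48 * ((x - y ^ 2) ^ 2 + x ^ 4) := by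
  have hx : x ^ 2 ≤ 1 := by nlinarith [sq_nonneg y]
  have hy : y ^ 2 ≤ 1 := by nlinarith [sq_nonneg x]
  have h₁ : x ^ 4 * y ^ 2 ≤ x ^ 4 := mul_le_of_le_one_right (by positivity) hy
  have h₂ : (y ^ 2) ^ 2 ≤ 2 * x ^ 2 + 2 * (x - y ^ 2) ^ 2 := by
    nlinarith [sq_nonneg (2 * x - y ^ 2)]
  have h₃ := mul_le_mul_of_nonneg_left h₂ (sq_nonneg x)
  have h₄ : x ^ 2 * (x - y ^ 2) ^ 2 ≤ (x - y ^ 2) ^ 2 :=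
    mul_le_of_le_one_left (sq_nonneg _) hx
  linarith [sq_nonneg (x - y ^ 2)]

theorem example_K2_equiv_T2 :
    (∃ C > (0 : ℝ), ∃ δ > (0 : ℝ), ∀ x y : ℝ, x ^ 2 + y ^ 2 ≤ δ ^ 2 →
        16 * (x ^ 2 + y ^ 2) * x ^ 2 * y ^ 2 ≤ C * ((x - y ^ 2) ^ 2 + x ^ 4)) ∧
    (∃ K > (0 : ℝ), ∃ δ > (0 : ℝ), ∀ x y : ℝ, x ^ 2 + y ^ 2 ≤ δ ^ 2 →
        exampleK2 x y ≤ K * exampleT2 x y) ∧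
    (∃ K' > (0 : ℝ), ∃ δ' > (0 : ℝ), ∀ x y : ℝ, x ^ 2 + y ^ 2 ≤ δ' ^ 2 →
        exampleT2 x y ≤ K' * exampleK2 x y) := by
  refine ⟨⟨48, by norm_num, 1, one_pos, fun x y h => ?_⟩,
    ⟨49, by norm_num, 1, one_pos, fun x y h => ?_⟩,
    ⟨1, one_pos, 1, one_pos, fun x y _ => ?_⟩⟩
  · exact jacobian_term_le x y (by simpa using h)
  · unfold exampleK2 exampleT2
    linarith [jacobian_term_le x y (by simpa using h)]
  · have h : 0 ≤ 16 * (x ^ 2 + y ^ 2) * x ^ 2 * y ^ 2 := by positivity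
    unfold exampleK2 exampleT2
    linarith
end

section
/- Let n ≥ p ≥ 1 and let f : ℝⁿ → ℝᵖ be a C¹ map on a neighbourhood of 0 with f(0)=0. Then K_1(f,·) ≈ T_1(f,·) holds if and only if for every positive integer m, K_m(f,·) ≈ T_m(f,·) holds. -/
/-- Domination of sums of `m`-th powers follows from domination of the plain sums. -/
theorem sum_pow_le_of_sum_le {α β : Type*} [Fintype α] [Fintype β] {a : α → ℝ} {b : β → ℝ}
    {K : ℝ} {m : ℕ} (hm : 0 < m) (ha : ∀ i, 0 ≤ a i) (hb : ∀ i, 0 ≤ b i) (hK : 0 ≤ K)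
    (h : ∑ i, a i ≤ K * ∑ i, b i) :
    ∑ i, a i ^ m ≤ K ^ m * (Fintype.card β : ℝ) ^ (m - 1) * ∑ i, b i ^ m := by
  obtain ⟨m, rfl⟩ : ∃ k, m = k + 1 := ⟨m - 1, by omega⟩
  calc ∑ i, a i ^ (m + 1) ≤ (∑ i, a i) ^ (m + 1) := by
        simp_rw [pow_succ, Finset.mul_sum]
        refine Finset.sum_le_sum fun i _ => ?_
        have := ha i
        gcongr
        exact Finset.single_le_sum (fun j _ => ha j) (Finset.mem_univ i)
    _ ≤ (K * ∑ i, b i) ^ (m + 1) := by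
        have := Finset.sum_nonneg fun i (_ : i ∈ Finset.univ) => ha i
        gcongr
    _ = K ^ (m + 1) * (∑ i, b i) ^ (m + 1) := mul_pow _ _ _
    _ ≤ K ^ (m + 1) * ((Fintype.card β : ℝ) ^ m * ∑ i, b i ^ (m + 1)) := by
        gcongr
        exact pow_sum_le_card_mul_sum_pow (fun i _ => hb i) m
    _ = _ := by rw [Nat.add_sub_cancel, mul_assoc]

/-- Local domination at exponent `1` implies local domination at every positive exponent, for
families of quantities that are sums of `m`-th powers of non-negative functions. -/
theorem exists_local_bound_pow {E α β : Type*} [Norm E] [Fintype α] [Fintype β] [Nonempty β]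
    {a : α → E → ℝ} {b : β → E → ℝ} {P Q : ℕ → E → ℝ}
    (ha : ∀ i x, 0 ≤ a i x) (hb : ∀ i x, 0 ≤ b i x)
    (hP : ∀ m, 0 < m → ∀ x, P m x = ∑ i, a i x ^ m)
    (hQ : ∀ m, 0 < m → ∀ x, Q m x = ∑ i, b i x ^ m)
    (h : ∃ K > (0 : ℝ), ∃ δ > (0 : ℝ), ∀ x : E, ‖x‖ ≤ δ → P 1 x ≤ K * Q 1 x)
    {m : ℕ} (hm : 0 < m) :
    ∃ K > (0 : ℝ), ∃ δ > (0 : ℝ), ∀ x : E, ‖x‖ ≤ δ → P m x ≤ K * Q m x := by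
  obtain ⟨K, hK, δ, hδ, h⟩ := h
  have hcard : (0 : ℝ) < Fintype.card β := by exact_mod_cast Fintype.card_pos
  refine ⟨K ^ m * (Fintype.card β : ℝ) ^ (m - 1), by positivity, δ, hδ, fun x hx => ?_⟩
  rw [hP m hm, hQ m hm]
  refine sum_pow_le_of_sum_le hm (fun i => ha i x) (fun i => hb i x) hK.le ?_
  simpa [hP 1 one_pos, hQ 1 one_pos] using h x hx

open scoped Classical in
theorem exists_kuoQ_eq_sum_pow (n p : ℕ)
    (f : EuclideanSpace ℝ (Fin n) → EuclideanSpace ℝ (Fin p)) :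
    ∃ a : Option (Fin p → Fin n) → EuclideanSpace ℝ (Fin n) → ℝ,
      (∀ i x, 0 ≤ a i x) ∧ ∀ m, 0 < m → ∀ x, KuoQ n p m f x = ∑ i, a i x ^ m := by
  refine ⟨fun i x => i.elim ‖f x‖ fun ι => ‖x‖ * if StrictMono ι then
    |(Matrix.det fun j k : Fin p => fderiv ℝ f x (EuclideanSpace.single (ι k) 1) j)| else 0,
    ?_, fun m hm x => ?_⟩
  · rintro (_ | ι) x
    · exact norm_nonneg _
    · dsimp only [Option.elim]
      split_ifs <;> positivity
  · simp only [KuoQ, Fintype.sum_option, Option.elim, mul_pow, ite_pow, zero_pow hm.ne',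
      Finset.mul_sum]
    rw [add_comm]

open scoped Classical in
theorem exists_thomQ_eq_sum_pow (n p : ℕ)
    (f : EuclideanSpace ℝ (Fin n) → EuclideanSpace ℝ (Fin p)) :
    ∃ a : Option (Fin (p + 1) → Fin n) → EuclideanSpace ℝ (Fin n) → ℝ,
      (∀ i x, 0 ≤ a i x) ∧ ∀ m, 0 < m → ∀ x, ThomQ n p m f x = ∑ i, a i x ^ m := by
  refine ⟨fun i x => i.elim ‖f x‖ fun ι => if StrictMono ι then
    |(Matrix.det fun j k : Fin (p + 1) =>
      if h : (j : ℕ) < p then fderiv ℝ f x (EuclideanSpace.single (ι k) 1) ⟨j, h⟩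
      else 2 * x (ι k))| else 0, ?_, fun m hm x => ?_⟩
  · rintro (_ | ι) x
    · exact norm_nonneg _
    · dsimp only [Option.elim]
      split_ifs <;> positivity
  · simp only [ThomQ, Fintype.sum_option, Option.elim, ite_pow, zero_pow hm.ne']
    rw [add_comm]

theorem kuo_equiv_thom_one_iff_all (n p : ℕ) (hp : 1 ≤ p) (hpn : p ≤ n)
    (f : EuclideanSpace ℝ (Fin n) → EuclideanSpace ℝ (Fin p))
    (U : Set (EuclideanSpace ℝ (Fin n))) (hU : U ∈ nhds 0)
    (hf : ContDiffOn ℝ 1 f U) (hf0 : f 0 = 0) :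
    ((∃ K > (0 : ℝ), ∃ δ > (0 : ℝ), ∀ x : EuclideanSpace ℝ (Fin n),
          ‖x‖ ≤ δ → KuoQ n p 1 f x ≤ K * ThomQ n p 1 f x) ∧
        (∃ K > (0 : ℝ), ∃ δ > (0 : ℝ), ∀ x : EuclideanSpace ℝ (Fin n),
          ‖x‖ ≤ δ → ThomQ n p 1 f x ≤ K * KuoQ n p 1 f x)) ↔
    (∀ m : ℕ, 0 < m →
      (∃ K > (0 : ℝ), ∃ δ > (0 : ℝ), ∀ x : EuclideanSpace ℝ (Fin n),
          ‖x‖ ≤ δ → KuoQ n p m f x ≤ K * ThomQ n p m f x) ∧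
        (∃ K > (0 : ℝ), ∃ δ > (0 : ℝ), ∀ x : EuclideanSpace ℝ (Fin n),
          ‖x‖ ≤ δ → ThomQ n p m f x ≤ K * KuoQ n p m f x)) := by
  obtain ⟨a, ha, hKuo⟩ := exists_kuoQ_eq_sum_pow n p f
  obtain ⟨b, hb, hThom⟩ := exists_thomQ_eq_sum_pow n p f
  refine ⟨fun ⟨hKT, hTK⟩ m hm => ?_, fun h => h 1 one_pos⟩
  exact ⟨exists_local_bound_pow (P := fun m => KuoQ n p m f) (Q := fun m => ThomQ n p m f)
      ha hb hKuo hThom hKT hm,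
    exists_local_bound_pow (P := fun m => ThomQ n p m f) (Q := fun m => KuoQ n p m f)
      hb ha hThom hKuo hTK hm⟩
end
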